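/- arXiv:1402.6496 — 3 statements merged into one kernel-verified Lean document; each statement's English description precedes it below -/
import Mathlib

section
/- Let d ≥ 2 be an integer, and set m = ⌊d/2⌋ and M = ⌈d/2⌉. Then for every finite set V ⊂ S^{d-1} with exactly d+2 elements one has vol(conv V) ≤ (1/d!) · (m+1)^{(m+1)/2} · (M+1)^{(M+1)/2} / (m^{m/2} · M^{M/2}), and there exists a set V ⊂ S^{d-1} with exactly d+2 elements for which equality holds. (In the paper's notation, v_d(d+2) equals this quantity.) -/
open MeasureTheory Real

theorem corner_volume (n : ℕ) : ∀ r : ℝ, 0 ≤ r →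
    volume {x : Fin n → ℝ | (∀ i, 0 ≤ x i) ∧ ∑ i, x i ≤ r} =
      ENNReal.ofReal (r ^ n / (n.factorial : ℝ)) := by
  induction n with
  | zero =>
    intro r hr
    have : {x : Fin 0 → ℝ | (∀ i, 0 ≤ x i) ∧ ∑ i, x i ≤ r} = Set.univ := by
      ext x; simp [hr]
    rw [this]
    simp [volume_pi]
  | succ n ih =>
    intro r hr
    have hmp := (volume_preserving_piFinSuccAbove (fun _ : Fin (n + 1) => ℝ) 0).symm
    have hclosed : IsClosed {x : Fin (n+1) → ℝ | (∀ i, 0 ≤ x i) ∧ ∑ i, x i ≤ r} := by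
      apply IsClosed.and
      · simp only [Set.ofPred_forall]
        exact isClosed_iInter fun i => isClosed_le continuous_const (continuous_apply i)
      · exact isClosed_le (by fun_prop) continuous_const
    rw [← hmp.measure_preimage hclosed.measurableSet.nullMeasurableSet]
    rw [Measure.volume_eq_prod, Measure.prod_apply (hmp.measurable hclosed.measurableSet)]
    have key : ∀ t : ℝ, volume (Prod.mk t ⁻¹' ((MeasurableEquiv.piFinSuccAbove (fun _ : Fin (n + 1) => ℝ) 0).symm ⁻¹'
        {x : Fin (n+1) → ℝ | (∀ i, 0 ≤ x i) ∧ ∑ i, x i ≤ r})) =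
        (Set.Icc 0 r).indicator (fun t => ENNReal.ofReal ((r - t) ^ n / (n.factorial : ℝ))) t := by
      intro t
      have hset : (Prod.mk t ⁻¹' ((MeasurableEquiv.piFinSuccAbove (fun _ : Fin (n + 1) => ℝ) 0).symm ⁻¹'
        {x : Fin (n+1) → ℝ | (∀ i, 0 ≤ x i) ∧ ∑ i, x i ≤ r})) =
          {y : Fin n → ℝ | 0 ≤ t ∧ (∀ i, 0 ≤ y i) ∧ t + ∑ i, y i ≤ r} := by
        ext y
        simp [MeasurableEquiv.piFinSuccAbove, Fin.insertNthEquiv, Fin.forall_fin_succ, Fin.sum_univ_succ, and_assoc]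
      rw [hset]
      by_cases ht : t ∈ Set.Icc 0 r
      · rw [Set.indicator_of_mem ht, ← ih (r - t) (by linarith [ht.2])]
        congr 1
        ext y
        simp only [Set.mem_ofPred_eq, ht.1, true_and]
        constructor
        · rintro ⟨h, h'⟩; exact ⟨h, by linarith⟩
        · rintro ⟨h, h'⟩; exact ⟨h, by linarith⟩
      · rw [Set.indicator_of_notMem ht]
        convert measure_empty (μ := (volume : Measure (Fin n → ℝ)))
        ext y
        simp only [Set.mem_ofPred_eq, Set.mem_empty_iff_false, iff_false]
        rintro ⟨h1, h2, h3⟩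
        exact ht ⟨h1, by linarith [Finset.sum_nonneg (fun i (_ : i ∈ Finset.univ) => h2 i)]⟩
    simp_rw [key]
    rw [lintegral_indicator measurableSet_Icc, ← ofReal_integral_eq_lintegral_ofReal]
    · congr 1
      rw [integral_Icc_eq_integral_Ioc, ← intervalIntegral.integral_of_le hr,
        intervalIntegral.integral_comp_sub_left (fun t => t ^ n / (n.factorial : ℝ)),
        intervalIntegral.integral_div, integral_pow, Nat.factorial_succ]
      push_cast
      have : (n.factorial : ℝ) ≠ 0 := by positivity
      field_simp
      simp
    · exact (Continuous.continuousOn (by fun_prop)).integrableOn_Icc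
    · refine (ae_restrict_iff' measurableSet_Icc).2 (Filter.Eventually.of_forall fun t ht => ?_)
      have : 0 ≤ r - t := by linarith [ht.2]
      show 0 ≤ (r - t) ^ n / (n.factorial : ℝ)
      positivity

theorem mem_hull {ι E : Type*} [Fintype ι] [AddCommGroup E] [Module ℝ E] (p : ι → E) (s : Set ι) (x : E) :
    x ∈ convexHull ℝ (p '' s) ↔ ∃ w : ι → ℝ, (∀ k, 0 ≤ w k) ∧ ∑ k, w k = 1 ∧
      (∀ k, k ∉ s → w k = 0) ∧ ∑ k, w k • p k = x := by
  classical
  constructor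
  · intro hx
    have hconv : Convex ℝ {x : E | ∃ w : ι → ℝ, (∀ k, 0 ≤ w k) ∧ ∑ k, w k = 1 ∧
      (∀ k, k ∉ s → w k = 0) ∧ ∑ k, w k • p k = x} := by
      rintro x ⟨w, h0, h1, h2, rfl⟩ y ⟨v, g0, g1, g2, rfl⟩ a b ha hb hab
      refine ⟨fun k => a * w k + b * v k, fun k => ?_, ?_, fun k hk => ?_, ?_⟩
      · have := h0 k; have := g0 k; positivity
      · rw [Finset.sum_add_distrib, ← Finset.mul_sum, ← Finset.mul_sum, h1, g1]; linarith
      · simp [h2 k hk, g2 k hk]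
      · simp only [add_smul, mul_smul, Finset.sum_add_distrib, Finset.smul_sum]
    refine convexHull_min ?_ hconv hx
    rintro _ ⟨k, hk, rfl⟩
    refine ⟨Pi.single k 1, fun j => ?_, by simp, fun j hj => ?_, ?_⟩
    · by_cases h : j = k
      · subst h; simp
      · simp [h]
    · have : j ≠ k := by rintro rfl; exact hj hk
      simp [this]
    · simp [Pi.single_apply, ite_smul]
  · rintro ⟨w, h0, h1, h2, rfl⟩
    have e1 : ∑ k, w k • p k = ∑ k with k ∈ s, w k • p k := by
      rw [Finset.sum_filter]
      refine Finset.sum_congr rfl fun k _ => ?_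
      split_ifs with h
      · rfl
      · simp [h2 k h]
    have e2 : ∑ k with k ∈ s, w k = 1 := by
      rw [← h1, Finset.sum_filter]
      refine Finset.sum_congr rfl fun k _ => ?_
      split_ifs with h
      · rfl
      · simp [h2 k h]
    rw [e1]
    refine (convex_convexHull ℝ _).sum_mem (fun k _ => h0 k) e2 fun k hk => ?_
    exact subset_convexHull ℝ _ ⟨k, (Finset.mem_filter.1 hk).2, rfl⟩

theorem simplex_volume (n : ℕ) (p : Fin (n + 1) → (Fin n → ℝ)) :
    volume (convexHull ℝ (Set.range p)) =
      ENNReal.ofReal (|(Matrix.of fun k : Fin n => p k.succ - p 0).det| / (n.factorial : ℝ)) := by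
  set A : Matrix (Fin n) (Fin n) ℝ := Matrix.of fun k : Fin n => p k.succ - p 0 with hA
  have himg : convexHull ℝ (Set.range p) = (fun x => p 0 + x) '' (Matrix.toLin' A.transpose ''
      {x : Fin n → ℝ | (∀ i, 0 ≤ x i) ∧ ∑ i, x i ≤ 1}) := by
    have hval : ∀ y : Fin n → ℝ, Matrix.toLin' A.transpose y = ∑ k, y k • (p k.succ - p 0) := by
      intro y
      ext j
      simp [Matrix.toLin'_apply, Matrix.mulVec, dotProduct, hA, mul_comm]
    ext x
    rw [← Set.image_univ, mem_hull]
    simp only [Set.mem_image, Set.mem_ofPred_eq, exists_exists_and_eq_and, hval]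
    constructor
    · rintro ⟨w, h0, h1, -, rfl⟩
      refine ⟨fun k => w k.succ, ⟨fun k => h0 _, ?_⟩, ?_⟩
      · rw [Fin.sum_univ_succ] at h1; linarith [h0 0]
      · rw [Fin.sum_univ_succ] at h1 ⊢
        have : w 0 = 1 - ∑ i : Fin n, w i.succ := by linarith
        rw [this]
        simp only [smul_sub, Finset.sum_sub_distrib, sub_smul, one_smul, Finset.sum_smul]
        abel
    · rintro ⟨y, ⟨h0, h1⟩, rfl⟩
      refine ⟨Fin.cons (1 - ∑ i, y i) y, ?_, ?_, by simp, ?_⟩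
      · intro k
        refine Fin.cases ?_ (fun i => ?_) k
        · simpa using h1
        · simpa using h0 i
      · simp [Fin.sum_univ_succ]
      · simp only [Fin.sum_univ_succ, Fin.cons_zero, Fin.cons_succ, smul_sub, Finset.sum_sub_distrib, sub_smul, one_smul, Finset.sum_smul]
        abel
  rw [himg, Set.image_add_left, measure_preimage_add, Measure.addHaar_image_linearMap, corner_volume n 1 zero_le_one,
    LinearMap.det_toLin', Matrix.det_transpose, ← ENNReal.ofReal_mul (abs_nonneg _)]
  congr 1
  simp [div_eq_mul_inv]

def bigM {n : ℕ} (p : Fin (n + 2) → (Fin n → ℝ)) (ε : Fin (n + 2) → ℝ) :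
    Matrix (Fin (n + 2)) (Fin (n + 2)) ℝ :=
  Matrix.of fun k => Fin.cons (ε k) (Fin.cons 1 (p k) : Fin (n + 1) → ℝ)

noncomputable def cof {n : ℕ} (p : Fin (n + 2) → (Fin n → ℝ)) (i : Fin (n + 2)) : ℝ :=
  (-1) ^ (i : ℕ) * (Matrix.of fun k : Fin (n + 1) =>
    (Fin.cons 1 (p (i.succAbove k)) : Fin (n + 1) → ℝ)).det

theorem det_bigM {n : ℕ} (p : Fin (n + 2) → (Fin n → ℝ)) (ε : Fin (n + 2) → ℝ) :
    (bigM p ε).det = ∑ i, ε i * cof p i := by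
  rw [Matrix.det_succ_column_zero]
  refine Finset.sum_congr rfl fun i _ => ?_
  have : (bigM p ε).submatrix i.succAbove Fin.succ = Matrix.of fun k : Fin (n + 1) =>
    (Fin.cons 1 (p (i.succAbove k)) : Fin (n + 1) → ℝ) := by
    ext a b
    simp [bigM]
  rw [this, cof]
  simp only [bigM, Matrix.of_apply, Fin.cons_zero]
  ring

theorem sum_cof {n : ℕ} (p : Fin (n + 2) → (Fin n → ℝ)) : ∑ i, cof p i = 0 := by
  have h := det_bigM p (fun _ => 1)
  rw [Matrix.det_zero_of_column_eq (i := 0) (j := 1) (by simp) (by intro k; simp [bigM, Fin.cons_one])] at h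
  simpa using h.symm

theorem sum_cof_smul {n : ℕ} (p : Fin (n + 2) → (Fin n → ℝ)) : ∑ i, cof p i • p i = 0 := by
  ext j
  have h := det_bigM p (fun k => p k j)
  rw [Matrix.det_zero_of_column_eq (i := 0) (j := j.succ.succ) (Fin.succ_ne_zero _).symm
    (by intro k; simp [bigM])] at h
  simp only [Finset.sum_apply, Pi.smul_apply, smul_eq_mul, Pi.zero_apply]
  rw [h]
  exact Finset.sum_congr rfl fun i _ => mul_comm _ _

theorem det_cons_one {n : ℕ} (q : Fin (n + 1) → (Fin n → ℝ)) :
    (Matrix.of fun k : Fin (n + 1) => (Fin.cons 1 (q k) : Fin (n + 1) → ℝ)).det =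
      (Matrix.of fun k : Fin n => q k.succ - q 0).det := by
  set B : Matrix (Fin (n+1)) (Fin (n+1)) ℝ :=
    Matrix.of fun k : Fin (n + 1) => (Fin.cons 1 (q k) : Fin (n + 1) → ℝ) with hB
  let c : Fin (n + 1) → ℝ := fun k => if k = 0 then 0 else -1
  let A : Matrix (Fin (n+1)) (Fin (n+1)) ℝ := Matrix.of fun i j => B i j + c i * B 0 j
  have hAB : A.det = B.det :=
    Matrix.det_eq_of_forall_row_eq_smul_add_const c 0 (by simp [c]) (fun i j => rfl)
  rw [← hAB, Matrix.det_succ_column_zero, Fin.sum_univ_succ, Finset.sum_eq_zero]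
  · have : A.submatrix (Fin.succAbove 0) Fin.succ = Matrix.of fun k : Fin n => q k.succ - q 0 := by
      ext a b
      simp [A, hB, c, sub_eq_add_neg]
    rw [this]
    simp [A, hB, c]
  · intro i _
    simp [A, hB, c]

theorem face_volume {n : ℕ} (p : Fin (n + 2) → (Fin n → ℝ)) (i : Fin (n + 2)) :
    volume (convexHull ℝ (p '' {i}ᶜ)) = ENNReal.ofReal (|cof p i| / (n.factorial : ℝ)) := by
  have : p '' {i}ᶜ = Set.range (fun k => p (i.succAbove k)) := by
    rw [← Fin.range_succAbove, ← Set.range_comp]; rfl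
  rw [this, simplex_volume, cof, det_cons_one]
  simp [abs_mul]

theorem hull_cover {n : ℕ} (p : Fin (n + 2) → (Fin n → ℝ)) (l : Fin (n + 2) → ℝ)
    (h0 : ∑ i, l i = 0) (h1 : ∑ i, l i • p i = 0) (hpos : ∃ i, 0 < l i) :
    convexHull ℝ (Set.range p) = ⋃ i ∈ Finset.univ.filter (fun i => 0 < l i), convexHull ℝ (p '' {i}ᶜ) := by
  apply Set.Subset.antisymm
  · intro x hx
    rw [← Set.image_univ, mem_hull] at hx
    obtain ⟨w, w0, w1, -, rfl⟩ := hx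
    obtain ⟨i, hi, hmin⟩ := Finset.exists_min_image (Finset.univ.filter (fun i => 0 < l i))
      (fun i => w i / l i) (by obtain ⟨i, hi⟩ := hpos; exact ⟨i, by simpa using hi⟩)
    simp only [Finset.mem_filter, Finset.mem_univ, true_and] at hi hmin
    simp only [Set.mem_iUnion]
    refine ⟨i, by simpa using hi, ?_⟩
    rw [mem_hull]
    have ht : 0 ≤ w i / l i := div_nonneg (w0 i) hi.le
    refine ⟨fun k => w k - w i / l i * l k, fun k => ?_, ?_, ?_, ?_⟩
    · by_cases hk : 0 < l k
      · have := hmin k hk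
        rw [le_div_iff₀ hk] at this
        linarith
      · have := w0 k
        nlinarith
    · rw [Finset.sum_sub_distrib, ← Finset.mul_sum, h0, w1]; simp
    · intro k hk
      have : k = i := by simpa using hk
      subst this
      field_simp
      simp
    · simp only [sub_smul, mul_smul, Finset.sum_sub_distrib, ← Finset.smul_sum, h1]
      simp
  · refine Set.iUnion₂_subset fun i _ => convexHull_mono (Set.image_subset_range _ _)

theorem dep_unique {n : ℕ} (p : Fin (n + 2) → (Fin n → ℝ)) (i : Fin (n + 2)) (hi : cof p i ≠ 0)
    (l : Fin (n + 2) → ℝ) (h0 : ∑ i, l i = 0) (h1 : ∑ i, l i • p i = 0) (k : Fin (n + 2)) :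
    l k = l i / cof p i * cof p k := by
  classical
  let v : Fin (n + 2) → ℝ := fun k => l k - l i / cof p i * cof p k
  have hv : v = 0 := by
    apply Matrix.eq_zero_of_vecMul_eq_zero (M := bigM p (Pi.single i 1))
    · rw [det_bigM]; simpa [Pi.single_apply] using hi
    · ext j
      simp only [Matrix.vecMul, dotProduct, Pi.zero_apply]
      refine Fin.cases ?_ (fun j => ?_) j
      · simp only [bigM, Matrix.of_apply, Fin.cons_zero]
        simp only [Pi.single_apply, mul_ite, mul_one, mul_zero, Finset.sum_ite_eq', Finset.mem_univ, if_true]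
        simp only [v]
        field_simp
        ring
      · refine Fin.cases ?_ (fun j => ?_) j
        · simp only [bigM, Matrix.of_apply, Fin.cons_zero, Fin.cons_succ, mul_one, v]
          rw [Finset.sum_sub_distrib, ← Finset.mul_sum, sum_cof, h0]; simp
        · simp only [bigM, Matrix.of_apply, Fin.cons_succ, v]
          have e1 := congrFun h1 j
          have e2 := congrFun (sum_cof_smul p) j
          simp only [Finset.sum_apply, Pi.smul_apply, smul_eq_mul, Pi.zero_apply] at e1 e2
          simp only [sub_mul, mul_assoc, Finset.sum_sub_distrib, ← Finset.mul_sum, e1, e2]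
          simp
  have := congrFun hv k
  simp only [v, Pi.zero_apply] at this
  linarith

theorem face_inter {n : ℕ} (hn : 1 ≤ n) (p : Fin (n + 2) → (Fin n → ℝ))
    (i j : Fin (n + 2)) (hij : i ≠ j) (hi : 0 < cof p i) (hj : 0 < cof p j) :
    volume (convexHull ℝ (p '' {i}ᶜ) ∩ convexHull ℝ (p '' {j}ᶜ)) = 0 := by
  classical
  have hsub : convexHull ℝ (p '' {i}ᶜ) ∩ convexHull ℝ (p '' {j}ᶜ) ⊆
      convexHull ℝ (p '' {i, j}ᶜ) := by
    rintro x ⟨hx, hy⟩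
    rw [mem_hull] at hx hy ⊢
    obtain ⟨a, a0, a1, a2, rfl⟩ := hx
    obtain ⟨b, b0, b1, b2, hb⟩ := hy
    have ai : a i = 0 := a2 i (by simp)
    have bj : b j = 0 := b2 j (by simp)
    have hu := dep_unique p i hi.ne' (fun k => a k - b k)
      (by rw [Finset.sum_sub_distrib, a1, b1, sub_self])
      (by simp only [sub_smul, Finset.sum_sub_distrib, hb, sub_self])
    have huj := hu j
    simp only [ai, bj] at huj
    have hbi : b i = 0 := by
      have h1 : (0 - b i) / cof p i ≤ 0 := div_nonpos_of_nonpos_of_nonneg (by linarith [b0 i]) hi.le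
      have h2 := a0 j
      have h3 : (0 - b i) / cof p i = 0 := by nlinarith
      rw [div_eq_zero_iff] at h3
      rcases h3 with h | h
      · linarith
      · exact absurd h hi.ne'
    have haj : a j = 0 := by rw [hbi] at huj; simpa using huj
    refine ⟨a, a0, a1, ?_, rfl⟩
    intro k hk
    have : k = i ∨ k = j := by simpa [or_iff_not_imp_left] using hk
    rcases this with rfl | rfl <;> assumption
  refine measure_mono_null hsub (measure_mono_null (convexHull_subset_affineSpan _) ?_)
  apply Measure.addHaar_affineSubspace
  intro htop
  obtain ⟨r, rfl⟩ : ∃ r, n = r + 1 := ⟨n - 1, by omega⟩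
  have hcard : (({i, j} : Finset (Fin (r + 1 + 2)))ᶜ).card = r + 1 := by
    rw [Finset.card_compl, Finset.card_pair hij]; simp
  have hle := finrank_vectorSpan_image_finset_le ℝ p _ hcard
  have hset : ((({i, j} : Finset (Fin (r + 1 + 2)))ᶜ.image p : Finset _) : Set (Fin (r+1) → ℝ)) = p '' {i, j}ᶜ := by
    rw [Finset.coe_image, Finset.coe_compl, Finset.coe_pair]
  rw [hset, ← direction_affineSpan, htop, AffineSubspace.direction_top, finrank_top] at hle
  simp at hle

theorem hull_volume {n : ℕ} (hn : 1 ≤ n) (p : Fin (n + 2) → (Fin n → ℝ)) :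
    (volume (convexHull ℝ (Set.range p))).toReal =
      (∑ i with 0 < cof p i, cof p i) / (n.factorial : ℝ) := by
  classical
  by_cases hN : ∃ i, cof p i ≠ 0
  · have hpos : ∃ i, 0 < cof p i := by
      by_contra! hneg
      obtain ⟨i, hi⟩ := hN
      exact hi ((Finset.sum_eq_zero_iff_of_nonpos (fun i _ => hneg i)).1 (sum_cof p) i (Finset.mem_univ _))
    rw [hull_cover p (cof p) (sum_cof p) (sum_cof_smul p) hpos, measure_biUnion_finset₀]
    · simp_rw [face_volume]
      rw [← ENNReal.ofReal_sum_of_nonneg (fun i _ => by positivity), ENNReal.toReal_ofReal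
        (Finset.sum_nonneg fun i _ => by positivity), Finset.sum_div]
      refine Finset.sum_congr rfl fun i hi => ?_
      rw [abs_of_pos (Finset.mem_filter.1 hi).2]
    · intro i hi j hj hij
      simp only [Finset.coe_filter, Finset.mem_univ, true_and] at hi hj
      exact face_inter hn p i j hij hi hj
    · intro i _
      exact ((Set.toFinite _).isCompact_convexHull (𝕜 := ℝ)).measurableSet.nullMeasurableSet
  · push Not at hN
    have : volume (convexHull ℝ (Set.range p)) = 0 := by
      obtain ⟨l, h1, h0, hne⟩ : ∃ l : Fin (n + 2) → ℝ, ∑ i, l i • p i = 0 ∧ ∑ i, l i = 0 ∧ ∃ i, l i ≠ 0 := by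
        have hna : ¬ AffineIndependent ℝ p := by
          intro h
          have := h.card_le_finrank_succ
          have h2 := Submodule.finrank_le (vectorSpan ℝ (Set.range p))
          simp at this h2
          omega
        rw [affineIndependent_iff] at hna
        push Not at hna
        obtain ⟨s, w, hw0, hw1, i, his, hi⟩ := hna
        refine ⟨fun k => if k ∈ s then w k else 0, ?_, ?_, i, by simpa [his] using hi⟩
        · simpa [ite_smul] using hw1
        · simpa using hw0
      have hpos : ∃ i, 0 < l i := by
        by_contra! hneg
        obtain ⟨i, hi⟩ := hne
        exact hi ((Finset.sum_eq_zero_iff_of_nonpos (fun i _ => hneg i)).1 h0 i (Finset.mem_univ _))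
      rw [hull_cover p l h0 h1 hpos]
      simp only [measure_iUnion_null_iff]
      intro i _
      rw [face_volume, hN i]; simp
    rw [this]
    simp [hN]

theorem hadamard_sq {N : ℕ} (A : Matrix (Fin N) (Fin N) ℝ) :
    A.det ^ 2 ≤ ∏ i, ∑ j, A i j ^ 2 := by
  have : Fact (Module.finrank ℝ (EuclideanSpace ℝ (Fin N)) = N) := ⟨by simp⟩
  let b := EuclideanSpace.basisFun (Fin N) ℝ
  let v : Fin N → EuclideanSpace ℝ (Fin N) := fun i => WithLp.toLp 2 (A i)
  have h := (b.toBasis.orientation).abs_volumeForm_apply_le v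
  rw [Orientation.volumeForm_robust' _ b, Module.Basis.det_apply] at h
  have hm : b.toBasis.toMatrix v = A.transpose := by
    ext i j
    simp [Module.Basis.toMatrix_apply, b, v]
  rw [hm, Matrix.det_transpose] at h
  calc A.det ^ 2 = |A.det| ^ 2 := (sq_abs _).symm
    _ ≤ (∏ i, ‖v i‖) ^ 2 := by gcongr
    _ = ∏ i, ∑ j, A i j ^ 2 := by
      rw [← Finset.prod_pow]
      refine Finset.prod_congr rfl fun i _ => ?_
      rw [EuclideanSpace.norm_sq_eq]
      simp [v]

theorem orth_sq {N : ℕ} (A : Matrix (Fin N) (Fin N) ℝ)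
    (h : ∀ i k, i ≠ k → ∑ j, A i j * A k j = 0) :
    A.det ^ 2 = ∏ i, ∑ j, A i j ^ 2 := by
  have : A * A.transpose = Matrix.diagonal fun i => ∑ j, A i j ^ 2 := by
    ext i k
    rw [Matrix.mul_apply, Matrix.diagonal_apply]
    split_ifs with hik
    · subst hik; simp [sq]
    · simpa using h i k hik
  have h2 := congrArg Matrix.det this
  rw [Matrix.det_mul, Matrix.det_transpose, Matrix.det_diagonal] at h2
  rw [sq, h2]

def rowM {n : ℕ} (p : Fin (n + 2) → (Fin n → ℝ)) (I : Finset (Fin (n + 2))) (x y : ℝ) :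
    Matrix (Fin (n + 2)) (Fin (n + 2)) ℝ :=
  Matrix.of fun k => Fin.cons (if k ∈ I then x else 0)
    (Fin.cons (if k ∈ I then 0 else y) (p k) : Fin (n + 1) → ℝ)

theorem det_rowM {n : ℕ} (p : Fin (n + 2) → (Fin n → ℝ)) (I : Finset (Fin (n + 2))) (x y : ℝ) :
    (rowM p I x y).det = x * y * ∑ i ∈ I, cof p i := by
  have h1 : rowM p I x y = Matrix.of fun i j =>
      (Fin.cons x (Fin.cons y (fun _ => 1) : Fin (n + 1) → ℝ) : Fin (n + 2) → ℝ) j * rowM p I 1 1 i j := by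
    ext i j
    refine Fin.cases ?_ (fun j => Fin.cases ?_ (fun j => ?_) j) j <;> simp [rowM]
  have h2 : bigM p (fun k => if k ∈ I then 1 else 0) = (rowM p I 1 1).updateCol 1
      (fun k => rowM p I 1 1 k 1 + (1 : ℝ) • rowM p I 1 1 k 0) := by
    ext i j
    refine Fin.cases ?_ (fun j => Fin.cases ?_ (fun j => ?_) j) j
    · rw [Matrix.updateCol_ne (by simp)]
      simp [rowM, bigM]
    · have : (Fin.succ 0 : Fin (n + 2)) = 1 := rfl
      rw [this, Matrix.updateCol_self]
      simp only [rowM, bigM, Matrix.of_apply, ← this, Fin.cons_succ, Fin.cons_zero]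
      split_ifs <;> simp
    · rw [Matrix.updateCol_ne (by simp [Fin.ext_iff])]
      simp [rowM, bigM]
  have h3 := det_bigM p (fun k => if k ∈ I then 1 else 0)
  rw [h2, Matrix.det_updateCol_add_smul_self _ (by simp)] at h3
  rw [h1, Matrix.det_mul_row, h3]
  simp [Fin.prod_univ_succ]

theorem prod_split {N : ℕ} (I : Finset (Fin N)) (a b : ℝ) :
    ∏ k : Fin N, (if k ∈ I then a else b) = a ^ I.card * b ^ (N - I.card) := by
  rw [Finset.prod_ite, Finset.prod_const, Finset.prod_const, Finset.filter_mem_eq_inter,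
    Finset.univ_inter, Finset.filter_not, Finset.filter_mem_eq_inter, Finset.univ_inter,
    ← Finset.compl_eq_univ_sdiff, Finset.card_compl, Fintype.card_fin]

theorem prod_rows {n : ℕ} (p : Fin (n + 2) → (Fin n → ℝ)) (hp : ∀ k, ∑ j, p k j ^ 2 = 1)
    (I : Finset (Fin (n + 2))) (x y : ℝ) :
    ∏ i, ∑ j, rowM p I x y i j ^ 2 = (1 + x ^ 2) ^ I.card * (1 + y ^ 2) ^ (n + 2 - I.card) := by
  rw [← prod_split]
  refine Finset.prod_congr rfl fun k _ => ?_
  simp only [rowM, Matrix.of_apply, Fin.sum_univ_succ, Fin.cons_zero, Fin.cons_succ, hp]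
  split_ifs <;> ring

theorem upper_sq {n : ℕ} (p : Fin (n + 2) → (Fin n → ℝ)) (hp : ∀ k, ∑ j, p k j ^ 2 = 1)
    (I : Finset (Fin (n + 2))) (a b : ℝ) (ha : 0 ≤ a) (hb : 0 ≤ b) :
    a * b * (∑ i ∈ I, cof p i) ^ 2 ≤ (1 + a) ^ I.card * (1 + b) ^ (n + 2 - I.card) := by
  have h := hadamard_sq (rowM p I √a √b)
  rw [prod_rows p hp, det_rowM, Real.sq_sqrt ha, Real.sq_sqrt hb, mul_pow, mul_pow,
    Real.sq_sqrt ha, Real.sq_sqrt hb] at h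
  exact h

theorem pow_balance (a b : ℝ) (hb : 1 ≤ b) (hab : b ≤ a) (k l m M : ℕ) (hk : k ≤ m) (h : k + l = m + M) :
    a ^ k * b ^ l ≤ a ^ m * b ^ M := by
  obtain ⟨t, rfl⟩ := Nat.exists_eq_add_of_le hk
  have : l = M + t := by omega
  subst this
  rw [pow_add, pow_add]
  have h1 : b ^ t ≤ a ^ t := pow_le_pow_left₀ (by linarith) hab t
  have h2 : 0 ≤ a ^ k * b ^ M := by
    have : 0 ≤ b := by linarith
    have : 0 ≤ a := by linarith
    positivity
  calc _ = a ^ k * b ^ M * b ^ t := by ring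
    _ ≤ a ^ k * b ^ M * a ^ t := by gcongr
    _ = _ := by ring

theorem upper_final {n : ℕ} (m M : ℕ) (hm : 1 ≤ m) (hmM : m ≤ M) (hM1 : M ≤ m + 1) (hn : n = m + M)
    (p : Fin (n + 2) → (Fin n → ℝ)) (hp : ∀ k, ∑ j, p k j ^ 2 = 1) (I : Finset (Fin (n + 2))) :
    (1 / (m : ℝ)) * (1 / (M : ℝ)) * (∑ i ∈ I, cof p i) ^ 2 ≤
      (1 + 1 / (m : ℝ)) ^ (m + 1) * (1 + 1 / (M : ℝ)) ^ (M + 1) := by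
  have hIc : I.card ≤ n + 2 := by simpa using Finset.card_le_univ I
  have hm0 : (0 : ℝ) < m := by exact_mod_cast hm
  have hle : (m : ℝ) ≤ M := by exact_mod_cast hmM
  have hM0 : (0 : ℝ) < M := by linarith
  have hb : (1 : ℝ) ≤ 1 + 1 / M := by
    have : 0 < 1 / (M : ℝ) := by positivity
    linarith
  have hab : 1 + 1 / (M : ℝ) ≤ 1 + 1 / (m : ℝ) := by gcongr
  by_cases hI : I.card ≤ m + 1
  · refine (upper_sq p hp I _ _ (by positivity) (by positivity)).trans ?_
    exact pow_balance _ _ hb hab _ _ _ _ hI (by omega)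
  · rw [mul_comm (1 / (m : ℝ))]
    refine (upper_sq p hp I _ _ (by positivity) (by positivity)).trans ?_
    rw [mul_comm]
    exact pow_balance _ _ hb hab _ _ _ _ (by omega) (by omega)

theorem bound_sq (m M : ℕ) (hm : 1 ≤ m) (hM : 1 ≤ M) :
    (((m : ℝ) + 1) ^ (((m : ℝ) + 1) / 2) * ((M : ℝ) + 1) ^ (((M : ℝ) + 1) / 2) /
              ((m : ℝ) ^ ((m : ℝ) / 2) * (M : ℝ) ^ ((M : ℝ) / 2))) ^ 2 =
    (m : ℝ) * M * ((1 + 1 / (m : ℝ)) ^ (m + 1) * (1 + 1 / (M : ℝ)) ^ (M + 1)) := by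
  have hm0 : (0 : ℝ) < m := by exact_mod_cast hm
  have hM0 : (0 : ℝ) < M := by exact_mod_cast hM
  have key : ∀ (x : ℝ) (k : ℕ), 0 ≤ x → (x ^ ((k : ℝ) / 2)) ^ 2 = x ^ k := by
    intro x k hx
    rw [← Real.rpow_natCast, ← Real.rpow_mul hx, ← Real.rpow_natCast x k]
    congr 1
    push_cast; ring
  have k1 := key (m + 1) (m + 1) (by positivity)
  have k2 := key (M + 1) (M + 1) (by positivity)
  push_cast at k1 k2
  rw [div_pow, mul_pow, mul_pow, k1, k2, key _ _ hm0.le, key _ _ hM0.le]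
  have e1 : (1 + 1 / (m : ℝ)) = (m + 1) / m := by field_simp
  have e2 : (1 + 1 / (M : ℝ)) = (M + 1) / M := by field_simp
  rw [e1, e2, div_pow, div_pow, pow_succ (m : ℝ), pow_succ (M : ℝ)]
  field_simp

theorem vol_transfer {n : ℕ} (p : Fin (n + 2) → EuclideanSpace ℝ (Fin n)) :
    volume (convexHull ℝ (Set.range p)) =
      volume (convexHull ℝ (Set.range fun k => (WithLp.ofLp (p k) : Fin n → ℝ))) := by
  have hset : convexHull ℝ (Set.range p) = (@WithLp.ofLp 2 (Fin n → ℝ)) ⁻¹'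
      (convexHull ℝ (Set.range fun k => (WithLp.ofLp (p k) : Fin n → ℝ))) := by
    ext x
    rw [Set.mem_preimage, ← Set.image_univ, ← Set.image_univ, mem_hull, mem_hull]
    have : ∀ w : Fin (n + 2) → ℝ, (∑ k, w k • p k = x ↔
        ∑ k, w k • (WithLp.ofLp (p k) : Fin n → ℝ) = WithLp.ofLp x) := by
      intro w
      rw [← (WithLp.ofLp_injective 2).eq_iff]
      simp
    simp only [this]
  rw [hset, (PiLp.volume_preserving_ofLp (Fin n)).measure_preimage]
  exact ((Set.finite_range _).isCompact_convexHull (𝕜 := ℝ)).measurableSet.nullMeasurableSet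

noncomputable def cc {N : ℕ} (I : Finset (Fin N)) (k : Fin N) (a b : ℝ) : ℝ := if k ∈ I then a else b

theorem exists_gram {n : ℕ} (m M : ℕ) (hm : 1 ≤ m) (hM : 1 ≤ M) (hn : n = m + M)
    (I : Finset (Fin (n + 2))) (hI : I.card = m + 1) :
    ∃ p : Fin (n + 2) → EuclideanSpace ℝ (Fin n), ∀ i k, inner ℝ (p i) (p k) =
      (if i = k then 1 + cc I k (1 / (m : ℝ)) (1 / (M : ℝ)) else 0) -
      (if (i ∈ I ↔ k ∈ I) then cc I k (1 / (m : ℝ)) (1 / (M : ℝ)) else 0) := by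
  classical
  have hJ : Iᶜ.card = M + 1 := by rw [Finset.card_compl, hI, Fintype.card_fin]; omega
  have hm0 : (0 : ℝ) < m := by exact_mod_cast hm
  have hM0 : (0 : ℝ) < M := by exact_mod_cast hM
  let e : Fin (n + 2) → EuclideanSpace ℝ (Fin (n + 2)) := fun i => EuclideanSpace.single i 1
  have hee : ∀ i k, inner ℝ (e i) (e k) = if i = k then (1 : ℝ) else 0 := by
    intro i k
    simp [e, EuclideanSpace.inner_single_left, Pi.single_apply]
  let u : Finset (Fin (n + 2)) → EuclideanSpace ℝ (Fin (n + 2)) := fun S => ∑ i ∈ S, e i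
  have heu : ∀ i S, inner ℝ (e i) (u S) = if i ∈ S then (1 : ℝ) else 0 := by
    intro i S
    simp [u, inner_sum, hee]
  have hue : ∀ i S, inner ℝ (u S) (e i) = if i ∈ S then (1 : ℝ) else 0 := by
    intro i S
    rw [real_inner_comm, heu]
  have huu : ∀ S T, inner ℝ (u S) (u T) = ((S ∩ T).card : ℝ) := by
    intro S T
    have : inner ℝ (u S) (u T) = ∑ i ∈ S, inner ℝ (e i) (u T) := by
      simp only [u, sum_inner]
    rw [this]
    simp only [heu]
    rw [Finset.sum_boole, Finset.filter_mem_eq_inter]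
  have hII : inner ℝ (u I) (u I) = (m : ℝ) + 1 := by rw [huu, Finset.inter_self, hI]; push_cast; rfl
  have hJJ : inner ℝ (u Iᶜ) (u Iᶜ) = (M : ℝ) + 1 := by rw [huu, Finset.inter_self, hJ]; push_cast; rfl
  have hIJ : inner ℝ (u I) (u Iᶜ) = (0 : ℝ) := by rw [huu]; simp
  have hJI : inner ℝ (u Iᶜ) (u I) = (0 : ℝ) := by rw [real_inner_comm, hIJ]
  let bb : Fin 2 → EuclideanSpace ℝ (Fin (n + 2)) := ![u I, u Iᶜ]
  let W := (Submodule.span ℝ (Set.range bb))ᗮ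
  have hli : LinearIndependent ℝ bb := by
    apply linearIndependent_of_ne_zero_of_inner_eq_zero (𝕜 := ℝ)
    · intro i
      fin_cases i
      · intro h
        have h' : u I = 0 := h
        rw [h', inner_zero_left] at hII
        linarith
      · intro h
        have h' : u Iᶜ = 0 := h
        rw [h', inner_zero_left] at hJJ
        linarith
    · intro i j hij
      fin_cases i <;> fin_cases j
      · exact absurd rfl hij
      · exact hIJ
      · exact hJI
      · exact absurd rfl hij
  have hW : Module.finrank ℝ W = n := by
    have h1 := Submodule.finrank_add_finrank_orthogonal (Submodule.span ℝ (Set.range bb))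
    rw [finrank_span_eq_card hli] at h1
    simp only [Fintype.card_fin, finrank_euclideanSpace] at h1
    have h2 : 2 + Module.finrank ℝ W = n + 2 := h1
    omega
  let b := (stdOrthonormalBasis ℝ W).reindex (finCongr hW)
  let q : Fin (n + 2) → EuclideanSpace ℝ (Fin (n + 2)) := fun i => if i ∈ I then √((m + 1) / m) • (e i - (1 / ((m : ℝ) + 1)) • u I)
    else √((M + 1) / M) • (e i - (1 / ((M : ℝ) + 1)) • u Iᶜ)
  have hqW : ∀ i, q i ∈ W := by
    intro i
    rw [Submodule.mem_orthogonal]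
    intro v hv
    induction hv using Submodule.span_induction with
    | mem v hv =>
      obtain ⟨t, rfl⟩ := hv
      have h2 : ∀ i, inner ℝ (u I) (q i) = 0 := by
        intro i
        by_cases hi : i ∈ I
        · simp only [q, hi, if_true, inner_smul_right, inner_sub_right, hue, hII]
          field_simp; simp
        · simp only [q, hi, if_false, inner_smul_right, inner_sub_right, hue, hIJ]
          simp
      have h3 : ∀ i, inner ℝ (u Iᶜ) (q i) = 0 := by
        intro i
        by_cases hi : i ∈ I
        · simp only [q, hi, if_true, inner_smul_right, inner_sub_right, hue, hJI, Finset.mem_compl]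
          simp
        · simp only [q, hi, if_false, inner_smul_right, inner_sub_right, hue, hJJ, Finset.mem_compl]
          simp; right; field_simp; simp
      fin_cases t
      · exact h2 i
      · exact h3 i
    | zero => simp
    | add x y _ _ hx hy => rw [inner_add_left, hx, hy, add_zero]
    | smul a x _ hx => rw [inner_smul_left, hx, mul_zero]
  refine ⟨fun i => b.repr ⟨q i, hqW i⟩, fun i k => ?_⟩
  rw [b.repr.inner_map_map, Submodule.coe_inner]
  have sm : √(((m : ℝ) + 1) / m) * √(((m : ℝ) + 1) / m) = (m + 1) / m := Real.mul_self_sqrt (by positivity)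
  have sM : √(((M : ℝ) + 1) / M) * √(((M : ℝ) + 1) / M) = (M + 1) / M := Real.mul_self_sqrt (by positivity)
  by_cases hi : i ∈ I <;> by_cases hk : k ∈ I
  · simp only [q, cc, hi, hk, if_true, inner_smul_right, inner_smul_left, inner_sub_right,
      inner_sub_left, hee, heu, hue, hII]
    simp only [conj_trivial]
    have hz : (1 : ℝ) - 1 / ((m : ℝ) + 1) * (m + 1) = 0 := by field_simp; simp
    rw [hz, mul_zero, mul_zero, sub_zero, ← mul_assoc, sm]
    split_ifs <;> field_simp <;> ring
  · have hik : i ≠ k := by rintro rfl; exact hk hi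
    simp only [q, cc, hi, hk, if_true, if_false, inner_smul_right, inner_smul_left, inner_sub_right,
      inner_sub_left, hee, heu, hue, hIJ, Finset.mem_compl, hik]
    simp
  · have hik : i ≠ k := by rintro rfl; exact hi hk
    simp only [q, cc, hi, hk, if_true, if_false, inner_smul_right, inner_smul_left, inner_sub_right,
      inner_sub_left, hee, heu, hue, hJI, Finset.mem_compl, hik]
    simp
  · simp only [q, cc, hi, hk, if_true, if_false, inner_smul_right, inner_smul_left, inner_sub_right,
      inner_sub_left, hee, heu, hue, hJJ, Finset.mem_compl, not_false_eq_true]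
    simp only [conj_trivial]
    have hz : (1 : ℝ) - 1 / ((M : ℝ) + 1) * (M + 1) = 0 := by field_simp; simp
    rw [hz, mul_zero, mul_zero, sub_zero, ← mul_assoc, sM]
    split_ifs <;> field_simp <;> ring

theorem example_sum {n : ℕ} (m M : ℕ) (hm : 1 ≤ m) (hM : 1 ≤ M) (hn : n = m + M)
    (I : Finset (Fin (n + 2))) (hI : I.card = m + 1) (p : Fin (n + 2) → (Fin n → ℝ))
    (hp : ∀ i k, ∑ j, p i j * p k j =
      (if i = k then 1 + cc I k (1 / (m : ℝ)) (1 / (M : ℝ)) else 0) -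
      (if (i ∈ I ↔ k ∈ I) then cc I k (1 / (m : ℝ)) (1 / (M : ℝ)) else 0)) :
    (∑ i with 0 < cof p i, cof p i) ^ 2 =
      (m : ℝ) * M * ((1 + 1 / (m : ℝ)) ^ (m + 1) * (1 + 1 / (M : ℝ)) ^ (M + 1)) := by
  classical
  have hm0 : (0 : ℝ) < m := by exact_mod_cast hm
  have hM0 : (0 : ℝ) < M := by exact_mod_cast hM
  have hp1 : ∀ k, ∑ j, p k j ^ 2 = 1 := by
    intro k
    simp_rw [sq]
    rw [hp]; simp
  -- the sum over I
  have hS : (∑ i ∈ I, cof p i) ^ 2 =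
      (m : ℝ) * M * ((1 + 1 / (m : ℝ)) ^ (m + 1) * (1 + 1 / (M : ℝ)) ^ (M + 1)) := by
    have h := orth_sq (rowM p I √(1 / (m : ℝ)) √(1 / (M : ℝ))) (by
      intro i k hik
      simp only [rowM, Matrix.of_apply, Fin.sum_univ_succ, Fin.cons_zero, Fin.cons_succ, hp, cc, hik, if_false]
      have s1 : √(1 / (m : ℝ)) * √(1 / (m : ℝ)) = 1 / m := Real.mul_self_sqrt (by positivity)
      have s2 : √(1 / (M : ℝ)) * √(1 / (M : ℝ)) = 1 / M := Real.mul_self_sqrt (by positivity)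
      by_cases hi : i ∈ I <;> by_cases hk : k ∈ I <;> simp only [hi, hk, if_true, if_false, s1, s2] <;> simp)
    rw [prod_rows p hp1, det_rowM, mul_pow, mul_pow, Real.sq_sqrt (by positivity),
      Real.sq_sqrt (by positivity), hI] at h
    have : n + 2 - (m + 1) = M + 1 := by omega
    rw [this] at h
    rw [← h]
    field_simp
  rw [← hS]
  -- the cofactors
  have hcompl : ∑ i ∈ Iᶜ, cof p i = - ∑ i ∈ I, cof p i := by
    have := Finset.sum_add_sum_compl I (cof p)
    rw [sum_cof] at this
    linarith
  have hN : ∀ k, (1 + cc I k (1 / (m : ℝ)) (1 / (M : ℝ))) * cof p k =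
      cc I k (1 / (m : ℝ)) (1 / (M : ℝ)) * (∑ i with (i ∈ I ↔ k ∈ I), cof p i) := by
    intro k
    have h0 : ∑ i, cof p i * ∑ j, p i j * p k j = 0 := by
      have h1 : ∑ j, (∑ i, cof p i • p i) j * p k j = 0 := by
        rw [sum_cof_smul]; simp
      rw [← h1]
      simp only [Finset.sum_apply, Pi.smul_apply, smul_eq_mul, Finset.sum_mul, Finset.mul_sum, mul_assoc]
      rw [Finset.sum_comm]
    simp only [hp, mul_sub, Finset.sum_sub_distrib, mul_ite, mul_zero, Finset.sum_ite_eq',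
      Finset.mem_univ, if_true] at h0
    rw [← Finset.sum_filter, ← Finset.sum_mul] at h0
    linarith
  have hNI : ∀ k ∈ I, (1 + 1 / (m : ℝ)) * cof p k = 1 / m * ∑ i ∈ I, cof p i := by
    intro k hk
    have := hN k
    simpa [cc, hk] using this
  have hNJ : ∀ k, k ∉ I → (1 + 1 / (M : ℝ)) * cof p k = - (1 / M * ∑ i ∈ I, cof p i) := by
    intro k hk
    have := hN k
    simp only [cc, hk, if_false, iff_false] at this
    rw [this, ← mul_neg, ← hcompl]
    congr 2
    ext; simp
  set S := ∑ i ∈ I, cof p i with hSdef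
  have cm : 0 < 1 + 1 / (m : ℝ) := by positivity
  have cM : 0 < 1 + 1 / (M : ℝ) := by positivity
  have dm : 0 < 1 / (m : ℝ) := by positivity
  have dM : 0 < 1 / (M : ℝ) := by positivity
  rcases lt_trichotomy S 0 with h | h | h
  · have : (Finset.univ.filter fun i => 0 < cof p i) = Iᶜ := by
      ext k
      simp only [Finset.mem_filter, Finset.mem_univ, true_and, Finset.mem_compl]
      constructor
      · intro hpos hk
        have := hNI k hk
        nlinarith [mul_pos cm hpos, mul_pos dm (neg_pos.2 h)]
      · intro hk
        have := hNJ k hk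
        by_contra! hneg
        nlinarith [mul_nonneg cM.le (neg_nonneg.2 hneg), mul_pos dM (neg_pos.2 h)]
    rw [this, hcompl]; ring
  · have : (Finset.univ.filter fun i => 0 < cof p i) = ∅ := by
      ext k
      simp only [Finset.mem_filter, Finset.mem_univ, true_and, Finset.notMem_empty, iff_false, not_lt]
      by_cases hk : k ∈ I
      · have := hNI k hk
        rw [h] at this
        by_contra! hpos
        nlinarith [mul_pos cm hpos]
      · have := hNJ k hk
        rw [h] at this
        by_contra! hpos
        nlinarith [mul_pos cM hpos]
    rw [this, h]; simp
  · have : (Finset.univ.filter fun i => 0 < cof p i) = I := by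
      ext k
      simp only [Finset.mem_filter, Finset.mem_univ, true_and]
      constructor
      · intro hpos
        by_contra hk
        have := hNJ k hk
        nlinarith [mul_pos cM hpos, mul_pos dM h]
      · intro hk
        have := hNI k hk
        by_contra! hneg
        nlinarith [mul_nonneg cm.le (neg_nonneg.2 hneg), mul_pos dm h]
    rw [this]

theorem max_volume_d_plus_2 (d : ℕ) (hd : 2 ≤ d) (m M : ℕ)
    (hm : m = d / 2) (hM : M = (d + 1) / 2) :
    (∀ V : Finset (EuclideanSpace ℝ (Fin d)),
        (V : Set (EuclideanSpace ℝ (Fin d))) ⊆ Metric.sphere 0 1 → V.card = d + 2 →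
        (volume (convexHull ℝ (V : Set (EuclideanSpace ℝ (Fin d))))).toReal ≤
          (1 / (Nat.factorial d : ℝ)) *
            (((m : ℝ) + 1) ^ (((m : ℝ) + 1) / 2) * ((M : ℝ) + 1) ^ (((M : ℝ) + 1) / 2) /
              ((m : ℝ) ^ ((m : ℝ) / 2) * (M : ℝ) ^ ((M : ℝ) / 2)))) ∧
    (∃ V : Finset (EuclideanSpace ℝ (Fin d)),
        (V : Set (EuclideanSpace ℝ (Fin d))) ⊆ Metric.sphere 0 1 ∧ V.card = d + 2 ∧
        (volume (convexHull ℝ (V : Set (EuclideanSpace ℝ (Fin d))))).toReal =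
          (1 / (Nat.factorial d : ℝ)) *
            (((m : ℝ) + 1) ^ (((m : ℝ) + 1) / 2) * ((M : ℝ) + 1) ^ (((M : ℝ) + 1) / 2) /
              ((m : ℝ) ^ ((m : ℝ) / 2) * (M : ℝ) ^ ((M : ℝ) / 2)))) := by
  classical
  have hm1 : 1 ≤ m := by omega
  have hmM : m ≤ M := by omega
  have hM1 : M ≤ m + 1 := by omega
  have hdm : d = m + M := by omega
  have hm0 : (0 : ℝ) < m := by exact_mod_cast hm1
  have hM0 : (0 : ℝ) < M := by exact_mod_cast hm1.trans hmM
  have hB := bound_sq m M hm1 (hm1.trans hmM)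
  have hBpos : 0 ≤ ((m : ℝ) + 1) ^ (((m : ℝ) + 1) / 2) * ((M : ℝ) + 1) ^ (((M : ℝ) + 1) / 2) /
              ((m : ℝ) ^ ((m : ℝ) / 2) * (M : ℝ) ^ ((M : ℝ) / 2)) := by positivity
  set B := ((m : ℝ) + 1) ^ (((m : ℝ) + 1) / 2) * ((M : ℝ) + 1) ^ (((M : ℝ) + 1) / 2) /
              ((m : ℝ) ^ ((m : ℝ) / 2) * (M : ℝ) ^ ((M : ℝ) / 2)) with hBdef
  constructor
  · intro V hV hcard
    let f := (V.equivFinOfCardEq hcard).symm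
    let p : Fin (d + 2) → EuclideanSpace ℝ (Fin d) := fun k => (f k : EuclideanSpace ℝ (Fin d))
    have hr : (V : Set (EuclideanSpace ℝ (Fin d))) = Set.range p := by
      ext x
      constructor
      · intro hx
        exact ⟨f.symm ⟨x, hx⟩, by simp [p]⟩
      · rintro ⟨k, rfl⟩
        exact (f k).2
    rw [hr, vol_transfer, hull_volume (by omega)]
    rw [one_div_mul_eq_div]
    gcongr
    refine le_of_sq_le_sq ?_ hBpos
    rw [hB]
    have hp : ∀ k, ∑ j, (WithLp.ofLp (p k) : Fin d → ℝ) j ^ 2 = 1 := by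
      intro k
      have h1 : ‖p k‖ = 1 := by simpa using hV (f k).2
      have h2 := EuclideanSpace.norm_sq_eq (p k)
      rw [h1] at h2
      simpa using h2.symm
    have h := upper_final m M hm1 hmM hM1 hdm _ hp
      (Finset.univ.filter fun i => 0 < cof (fun k => (WithLp.ofLp (p k) : Fin d → ℝ)) i)
    have h' := mul_le_mul_of_nonneg_left h (mul_pos hm0 hM0).le
    refine le_trans (le_of_eq ?_) h'
    field_simp
  · let I : Finset (Fin (d + 2)) := Finset.univ.filter fun i => (i : ℕ) < m + 1
    have hI : I.card = m + 1 := by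
      rw [Fin.card_filter_val_lt]; omega
    obtain ⟨p, hp⟩ := exists_gram m M hm1 (hm1.trans hmM) hdm I hI
    have hnorm : ∀ k, ‖p k‖ = 1 := by
      intro k
      have := hp k k
      rw [real_inner_self_eq_norm_sq] at this
      simp only [if_true, add_sub_cancel_right] at this
      nlinarith [norm_nonneg (p k)]
    have hinj : Function.Injective p := by
      intro i k hik
      by_contra hne
      have h1 := hp i k
      rw [hik, real_inner_self_eq_norm_sq, hnorm] at h1
      have : 0 ≤ cc I k (1 / (m : ℝ)) (1 / (M : ℝ)) := by
        unfold cc; split_ifs <;> positivity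
      simp only [hne, if_false] at h1
      split_ifs at h1 <;> linarith
    refine ⟨Finset.univ.image p, ?_, ?_, ?_⟩
    · intro x hx
      obtain ⟨k, -, rfl⟩ := Finset.mem_image.1 (Finset.mem_coe.1 hx)
      simpa using hnorm k
    · rw [Finset.card_image_of_injective _ hinj]; simp
    · rw [Finset.coe_image, Finset.coe_univ, Set.image_univ, vol_transfer, hull_volume (by omega),
        one_div_mul_eq_div]
      congr 1
      rw [← sq_eq_sq₀ (Finset.sum_nonneg fun i hi => (Finset.mem_filter.1 hi).2.le) hBpos, hB]
      apply example_sum m M hm1 (hm1.trans hmM) hdm I hI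
      intro i k
      rw [← hp i k]
      simp [PiLp.inner_apply, mul_comm]
end

section
/- Let d ≥ 2 be an integer and let V ⊂ S^{d-1} have exactly d+2 elements, with vol(conv V) ≥ vol(conv W) for every W ⊂ S^{d-1} with exactly d+2 elements. Then V admits a partition V = V₁ ∪ V₂ with |V₁| = ⌊d/2⌋+1 and |V₂| = ⌈d/2⌉+1 such that ⟨u,v⟩ = −1/⌊d/2⌋ for all distinct u,v ∈ V₁, ⟨u,v⟩ = −1/⌈d/2⌉ for all distinct u,v ∈ V₂, and ⟨u,v⟩ = 0 whenever u ∈ V₁ and v ∈ V₂. (Equivalently, V₁ and V₂ are vertex sets of regular simplices of dimensions ⌊d/2⌋ and ⌈d/2⌉ inscribed in S^{d-1}, contained in orthogonal linear subspaces of ℝ^d.) -/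
open MeasureTheory Real RealInnerProductSpace
open scoped Classical

namespace MaxVol

/-- the augmented matrix of `d+1` points -/
noncomputable def M {d : ℕ} (w : Fin (d+1) → EuclideanSpace ℝ (Fin d)) :
    Matrix (Fin (d+1)) (Fin (d+1)) ℝ :=
  Matrix.of fun a => Fin.cons 1 (fun k => w a k)

/-- the doubly augmented matrix of `d+2` points -/
noncomputable def N {d : ℕ} (c e : Fin (d+2) → ℝ) (v : Fin (d+2) → EuclideanSpace ℝ (Fin d)) :
    Matrix (Fin (d+2)) (Fin (d+2)) ℝ :=
  Matrix.of fun i => Fin.cons (c i) (Fin.cons (e i) (fun k => v i k))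

/-- the affine dependence -/
noncomputable def lam {d : ℕ} (v : Fin (d+2) → EuclideanSpace ℝ (Fin d)) (i : Fin (d+2)) : ℝ :=
  (-1)^(i:ℕ) * (M (v ∘ i.succAbove)).det

/-- vertices of the standard simplex -/
noncomputable def stdw (d : ℕ) : Fin (d+1) → EuclideanSpace ℝ (Fin d) :=
  Fin.cons 0 (fun k => EuclideanSpace.single k 1)

/-- volume of the standard simplex -/
noncomputable def C (d : ℕ) : ENNReal := volume (convexHull ℝ (Set.range (stdw d)))

lemma mem_hull {ι F : Type*} [Fintype ι] [AddCommGroup F] [Module ℝ F] (w : ι → F) (x : F) :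
    x ∈ convexHull ℝ (Set.range w) ↔ ∃ α : ι → ℝ, (∀ i, 0 ≤ α i) ∧ ∑ i, α i = 1 ∧
      ∑ i, α i • w i = x := by
  constructor
  · intro hx
    have : convexHull ℝ (Set.range w) ⊆ {x | ∃ α : ι → ℝ, (∀ i, 0 ≤ α i) ∧ ∑ i, α i = 1 ∧
      ∑ i, α i • w i = x} := by
      apply convexHull_min
      · rintro _ ⟨i, rfl⟩
        refine ⟨Pi.single i 1, fun j => ?_, by simp, ?_⟩
        · by_cases h : j = i
          · subst h; simp
          · simp [h]
        · simp [Pi.single_apply]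
      · rintro x ⟨α, h1, h2, rfl⟩ y ⟨β, h3, h4, rfl⟩ a b ha hb hab
        refine ⟨fun i => a * α i + b * β i, fun i => ?_, ?_, ?_⟩
        · have := h1 i; have := h3 i; positivity
        · rw [Finset.sum_add_distrib, ← Finset.mul_sum, ← Finset.mul_sum, h2, h4]; linarith
        · simp only [add_smul, Finset.sum_add_distrib, mul_smul, Finset.smul_sum]
    exact this hx
  · rintro ⟨α, h1, h2, h3⟩
    exact mem_convexHull_of_exists_fintype α w h1 h2 (fun i => Set.mem_range_self i) h3

lemma det_M {d : ℕ} (w : Fin (d+1) → EuclideanSpace ℝ (Fin d)) :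
    (M w).det = (Matrix.of fun (a k : Fin d) => w a.succ k - w 0 k).det := by
  have h : (M w).det = (Matrix.of (fun (a : Fin (d+1)) => (if a = 0 then (M w 0) else
      M w a - M w 0 : Fin (d+1) → ℝ)) : Matrix (Fin (d+1)) (Fin (d+1)) ℝ).det := by
    apply Matrix.det_eq_of_forall_row_eq_smul_add_const (fun a => if a = 0 then 0 else 1) 0 (by simp)
    intro i j
    by_cases hi : i = 0 <;> simp [hi]
  rw [h, Matrix.det_succ_column_zero, Fin.sum_univ_succ]
  simp [M, Matrix.submatrix]

lemma vol_simplex {d : ℕ} (w : Fin (d+1) → EuclideanSpace ℝ (Fin d)) :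
    volume (convexHull ℝ (Set.range w)) = ENNReal.ofReal |(M w).det| * C d := by
  set b := (EuclideanSpace.basisFun (Fin d) ℝ).toBasis with hb
  set L : EuclideanSpace ℝ (Fin d) →ₗ[ℝ] EuclideanSpace ℝ (Fin d) :=
    b.constr ℝ (fun k => w k.succ - w 0) with hL
  have hLk : ∀ k, L (EuclideanSpace.single k 1) = w k.succ - w 0 := by
    intro k
    have := b.constr_basis ℝ (fun k => w k.succ - w 0) k
    rwa [show b k = EuclideanSpace.single k 1 by simp [hb]] at this
  have hr : Set.range w = (fun x => w 0 + x) '' (L '' Set.range (stdw d)) := by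
    rw [← Set.range_comp, ← Set.range_comp]
    congr 1
    funext a
    refine Fin.cases ?_ (fun k => ?_) a
    · simp [stdw]
    · simp [stdw, hLk]
  have h2 : convexHull ℝ (Set.range w) = (fun x => w 0 + x) '' (L '' convexHull ℝ (Set.range (stdw d))) := by
    rw [hr, LinearMap.image_convexHull]
    have := (AffineEquiv.constVAdd ℝ (EuclideanSpace ℝ (Fin d)) (w 0)).toAffineMap.image_convexHull
      (L '' Set.range (stdw d))
    exact this.symm
  have hdet : LinearMap.det L = (M w).det := by
    rw [det_M, ← LinearMap.det_toMatrix b, ← Matrix.det_transpose]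
    congr 1
    ext i j
    simp [LinearMap.toMatrix_apply, hb, hLk]
  rw [h2, Set.image_add_left, measure_preimage_add, Measure.addHaar_image_linearMap, hdet, C]

lemma C_ne_top (d : ℕ) : C d ≠ ⊤ := by
  have : IsCompact (convexHull ℝ (Set.range (stdw d))) := (Set.finite_range _).isCompact_convexHull (𝕜 := ℝ)
  exact this.measure_lt_top.ne

lemma C_ne_zero (d : ℕ) : C d ≠ 0 := by
  have h : affineSpan ℝ (Set.range (stdw d)) = ⊤ := by
    have h0 : (0 : EuclideanSpace ℝ (Fin d)) ∈ Set.range (stdw d) := ⟨0, rfl⟩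
    rw [AffineSubspace.affineSpan_eq_top_iff_vectorSpan_eq_top_of_nonempty ℝ _ _ ⟨0, h0⟩,
      vectorSpan_eq_span_vsub_set_right ℝ h0, eq_top_iff,
      ← (EuclideanSpace.basisFun (Fin d) ℝ).toBasis.span_eq]
    apply Submodule.span_mono
    rintro _ ⟨k, rfl⟩
    refine ⟨stdw d k.succ, ⟨_, rfl⟩, by simp [stdw]⟩
  have h2 := interior_convexHull_nonempty_iff_affineSpan_eq_top.2 h
  intro h3
  have := measure_mono_null interior_subset h3
  exact (isOpen_interior.measure_pos volume h2).ne' this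

lemma det_N_one {d : ℕ} (c : Fin (d+2) → ℝ) (v : Fin (d+2) → EuclideanSpace ℝ (Fin d)) :
    (N c 1 v).det = ∑ i, c i * lam v i := by
  rw [Matrix.det_succ_column_zero]
  apply Finset.sum_congr rfl
  intro i _
  have : (N c 1 v).submatrix i.succAbove Fin.succ = M (v ∘ i.succAbove) := by
    ext a b; simp [N, M]
  rw [this]
  simp [N, lam]; ring

lemma sum_lam {d : ℕ} (v : Fin (d+2) → EuclideanSpace ℝ (Fin d)) : ∑ i, lam v i = 0 := by
  have h := det_N_one 1 v
  rw [Matrix.det_zero_of_column_eq (i := 0) (j := 1) (by simp)] at h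
  · simpa using h.symm
  · intro k; simp [N]

lemma sum_lam_smul {d : ℕ} (v : Fin (d+2) → EuclideanSpace ℝ (Fin d)) :
    ∑ i, lam v i • v i = 0 := by
  ext k
  have h := det_N_one (fun i => v i k) v
  rw [Matrix.det_zero_of_column_eq (i := 0) (j := k.succ.succ) (by simp [Fin.ext_iff])] at h
  · simp only [WithLp.ofLp_sum, WithLp.ofLp_smul, Finset.sum_apply, Pi.smul_apply, smul_eq_mul]
    simpa [mul_comm] using h.symm
  · intro k; simp [N]

/-- the facet simplex omitting `i` -/
def S {d : ℕ} (v : Fin (d+2) → EuclideanSpace ℝ (Fin d)) (i : Fin (d+2)) :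
    Set (EuclideanSpace ℝ (Fin d)) := convexHull ℝ (Set.range (v ∘ i.succAbove))

lemma vol_S {d : ℕ} (v : Fin (d+2) → EuclideanSpace ℝ (Fin d)) (i : Fin (d+2)) :
    volume (S v i) = ENNReal.ofReal |lam v i| * C d := by
  rw [S, vol_simplex, lam, abs_mul]; simp

lemma mem_S {d : ℕ} (v : Fin (d+2) → EuclideanSpace ℝ (Fin d)) (i : Fin (d+2)) (x) :
    x ∈ S v i ↔ ∃ α : Fin (d+2) → ℝ, (∀ i, 0 ≤ α i) ∧ ∑ i, α i = 1 ∧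
      ∑ i, α i • v i = x ∧ α i = 0 := by
  rw [S, mem_hull]
  constructor
  · rintro ⟨α, h1, h2, h3⟩
    refine ⟨i.insertNth 0 α, fun j => ?_, ?_, ?_, by simp⟩
    · refine Fin.succAboveCases i ?_ (fun k => ?_) j
      · simp
      · simpa using h1 k
    · rw [Fin.sum_univ_succAbove _ i]; simpa using h2
    · rw [Fin.sum_univ_succAbove _ i]; simpa using h3
  · rintro ⟨α, h1, h2, h3, h4⟩
    rw [Fin.sum_univ_succAbove _ i, h4] at h2 h3
    exact ⟨α ∘ i.succAbove, fun j => h1 _, by simpa using h2, by simpa using h3⟩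

lemma dep_unique {d : ℕ} (v : Fin (d+2) → EuclideanSpace ℝ (Fin d)) (i : Fin (d+2))
    (hi : lam v i ≠ 0) (γ : Fin (d+2) → ℝ) (h1 : ∑ j, γ j = 0) (h2 : ∑ j, γ j • v j = 0)
    (h3 : γ i = 0) : γ = 0 := by
  rw [Fin.sum_univ_succAbove _ i, h3] at h1 h2
  have hdet : (M (v ∘ i.succAbove)).det ≠ 0 := by
    intro h; apply hi; simp [lam, h]
  have h : Matrix.vecMul (γ ∘ i.succAbove) (M (v ∘ i.succAbove)) = 0 := by
    funext k
    refine Fin.cases ?_ (fun k => ?_) k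
    · simpa [Matrix.vecMul, dotProduct, M] using h1
    · have := congrArg (fun x : EuclideanSpace ℝ (Fin d) => x k) h2
      simpa [Matrix.vecMul, dotProduct, M] using this
  have h0 := Matrix.eq_zero_of_vecMul_eq_zero hdet h
  funext j
  refine Fin.succAboveCases i ?_ (fun k => ?_) j
  · simpa using h3
  · exact congrFun h0 k

lemma null_inter {d : ℕ} (v : Fin (d+2) → EuclideanSpace ℝ (Fin d)) (i j : Fin (d+2)) (hij : i ≠ j)
    (hi : 0 < lam v i) (hj : 0 < lam v j) : volume (S v i ∩ S v j) = 0 := by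
  set T : Finset (Fin (d+2)) := Finset.univ \ {i, j} with hT
  have hTc : T.card = d := by
    rw [hT, Finset.card_sdiff_of_subset (by simp), Finset.card_pair hij]; simp
  have hsub : S v i ∩ S v j ⊆ affineSpan ℝ (v '' T) := by
    rintro x ⟨hx, hy⟩
    rw [mem_S] at hx hy
    obtain ⟨α, a1, a2, a3, a4⟩ := hx
    obtain ⟨β, b1, b2, b3, b4⟩ := hy
    have hz : (fun k => (α k - β k) + (β i / lam v i) * lam v k) = 0 := by
      apply dep_unique v i hi.ne'
      · simp [Finset.sum_add_distrib, Finset.sum_sub_distrib, ← Finset.mul_sum, sum_lam, a2, b2]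
      · simp only [add_smul, sub_smul, Finset.sum_add_distrib, Finset.sum_sub_distrib, mul_smul,
          ← Finset.smul_sum, sum_lam_smul, a3, b3]
        simp
      · simp only [a4]; field_simp; ring
    have hjj := congrFun hz j
    simp only [b4, Pi.zero_apply, sub_zero] at hjj
    have : 0 ≤ (β i / lam v i) * lam v j := by
      have := b1 i; positivity
    have hαj : α j = 0 := le_antisymm (by linarith) (a1 j)
    have hout : ∀ k, k ∉ T → α k = 0 := by
      intro k hk
      simp only [hT, Finset.mem_sdiff, Finset.mem_univ, true_and, not_not, Finset.mem_insert,
        Finset.mem_singleton] at hk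
      rcases hk with rfl | rfl <;> assumption
    apply convexHull_subset_affineSpan
    rw [← a3, ← Finset.sum_subset (Finset.subset_univ T) (fun k _ hk => by simp [hout k hk])]
    apply (convex_convexHull ℝ _).sum_mem (fun k _ => a1 k)
    · rw [Finset.sum_subset (Finset.subset_univ T) (fun k _ hk => hout k hk), a2]
    · intro k hk
      exact subset_convexHull _ _ ⟨k, hk, rfl⟩
  refine measure_mono_null hsub (Measure.addHaar_affineSubspace volume _ ?_)
  intro htop
  rcases Nat.eq_zero_or_pos d with h0 | hpos
  · have : T = ∅ := by rw [← Finset.card_eq_zero, hTc, h0]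
    rw [this] at htop
    simp at htop
  · have h1 := finrank_vectorSpan_image_finset_le ℝ v T (n := d - 1) (by omega)
    have h2 : vectorSpan ℝ (v '' T) = ⊤ := by
      rw [← direction_affineSpan, htop, AffineSubspace.direction_top]
    rw [Finset.coe_image, h2] at h1
    simp at h1
    omega

/-- The sum of the positive coefficients. -/
noncomputable def pos {d : ℕ} (v : Fin (d+2) → EuclideanSpace ℝ (Fin d)) : Finset (Fin (d+2)) :=
  Finset.univ.filter fun i => 0 < lam v i

lemma vol_ge {d : ℕ} (v : Fin (d+2) → EuclideanSpace ℝ (Fin d)) :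
    ENNReal.ofReal (∑ i ∈ pos v, lam v i) * C d ≤ volume (convexHull ℝ (Set.range v)) := by
  have h1 : volume (⋃ i ∈ pos v, S v i) = ∑ i ∈ pos v, volume (S v i) := by
    apply measure_biUnion_finset₀
    · intro i hi j hj hij
      simp [pos] at hi hj
      exact null_inter v i j hij hi hj
    · intro i _
      exact (convex_convexHull ℝ _).nullMeasurableSet volume
  have h2 : ∑ i ∈ pos v, volume (S v i) = ENNReal.ofReal (∑ i ∈ pos v, lam v i) * C d := by
    rw [ENNReal.ofReal_sum_of_nonneg, Finset.sum_mul]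
    · apply Finset.sum_congr rfl
      intro i hi
      simp [pos] at hi
      rw [vol_S, abs_of_pos hi]
    · intro i hi
      simp [pos] at hi
      exact hi.le
  rw [← h2, ← h1]
  apply measure_mono
  refine Set.iUnion₂_subset fun i _ => convexHull_mono ?_
  exact Set.range_comp_subset_range _ _

lemma vol_le {d : ℕ} (v : Fin (d+2) → EuclideanSpace ℝ (Fin d)) :
    volume (convexHull ℝ (Set.range v)) ≤ ENNReal.ofReal (∑ i ∈ pos v, lam v i) * C d := by
  by_cases hne : (pos v).Nonempty
  · have h2 : ∑ i ∈ pos v, volume (S v i) = ENNReal.ofReal (∑ i ∈ pos v, lam v i) * C d := by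
      rw [ENNReal.ofReal_sum_of_nonneg, Finset.sum_mul]
      · apply Finset.sum_congr rfl
        intro i hi
        simp [pos] at hi
        rw [vol_S, abs_of_pos hi]
      · intro i hi
        simp [pos] at hi
        exact hi.le
    rw [← h2]
    refine le_trans (measure_mono ?_) (measure_biUnion_finset_le _ _)
    intro x hx
    rw [mem_hull] at hx
    obtain ⟨α, a1, a2, a3⟩ := hx
    obtain ⟨i, hi, hmin⟩ := Finset.exists_min_image (pos v) (fun i => α i / lam v i) hne
    rw [Set.mem_iUnion₂]
    refine ⟨i, hi, ?_⟩
    simp only [pos, Finset.mem_filter, Finset.mem_univ, true_and] at hi hmin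
    rw [mem_S]
    refine ⟨fun k => α k - α i / lam v i * lam v k, fun k => ?_, ?_, ?_, ?_⟩
    · by_cases hk : 0 < lam v k
      · have := hmin k hk
        rw [le_div_iff₀ hk] at this
        linarith
      · have h1 : 0 ≤ α i / lam v i := div_nonneg (a1 i) hi.le
        have := a1 k
        nlinarith
    · simp [Finset.sum_sub_distrib, ← Finset.mul_sum, sum_lam, a2]
    · simp only [sub_smul, Finset.sum_sub_distrib, mul_smul,
          ← Finset.smul_sum, sum_lam_smul, a3]
      simp
    · field_simp; ring
  · have hz : ∀ i, lam v i = 0 := by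
      have hle : ∀ i ∈ Finset.univ, lam v i ≤ 0 := by
        intro i _
        by_contra h
        exact hne ⟨i, by simpa [pos] using h⟩
      have := (Finset.sum_eq_zero_iff_of_nonpos hle).1 (sum_lam v)
      simpa using this
    have hcov : convexHull ℝ (Set.range v) ⊆ ⋃ i, S v i := by
      rw [convexHull_eq_union]
      intro x hx
      simp only [Set.mem_iUnion] at hx
      obtain ⟨t, ht, hind, hx⟩ := hx
      have hc : t.card ≤ d + 1 := by
        have := hind.card_le_finrank_succ
        have h2 := Submodule.finrank_le (vectorSpan ℝ (Set.range ((↑) : t → EuclideanSpace ℝ (Fin d))))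
        simp at this h2
        omega
      have : ∃ i : Fin (d+2), t ⊆ Finset.univ.image (v ∘ i.succAbove) := by
        choose! g hg using fun y (hy : y ∈ t) => ht hy
        have hcard : (t.image g).card < (Finset.univ : Finset (Fin (d+2))).card := by
          have := Finset.card_image_le (s := t) (f := g)
          simp; omega
        obtain ⟨i, _, hi⟩ := Finset.exists_mem_notMem_of_card_lt_card hcard
        refine ⟨i, fun y hy => ?_⟩
        have hne : g y ≠ i := by
          rintro rfl
          exact hi (Finset.mem_image_of_mem g hy)
        obtain ⟨k, hk⟩ := Fin.exists_succAbove_eq hne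
        simp only [Finset.mem_image, Finset.mem_univ, true_and]
        exact ⟨k, by simp [hk, hg y hy]⟩
      obtain ⟨i, hi⟩ := this
      refine Set.mem_iUnion.2 ⟨i, convexHull_mono ?_ hx⟩
      intro y hy
      simpa using hi hy
    have : volume (⋃ i, S v i) = 0 := by
      rw [measure_iUnion_null_iff]
      intro i
      rw [vol_S, hz i]; simp
    rw [measure_mono_null hcov this]
    exact bot_le

lemma all_one {n : ℕ} (x : Fin n → ℝ) (h0 : ∀ i, 0 ≤ x i) (hs : ∑ i, x i = n)
    (hp : 1 ≤ ∏ i, x i) : ∀ i, x i = 1 := by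
  have hpos : ∀ i, 0 < x i := by
    intro i
    refine lt_of_le_of_ne (h0 i) (fun h => ?_)
    rw [Finset.prod_eq_zero (Finset.mem_univ i) h.symm] at hp
    linarith
  have hlog : 0 ≤ ∑ i, Real.log (x i) := by
    rw [← Real.log_prod (fun i _ => (hpos i).ne')]
    exact Real.log_nonneg hp
  have hnn : ∀ i ∈ Finset.univ, 0 ≤ x i - 1 - Real.log (x i) := fun i _ => by
    have := Real.log_le_sub_one_of_pos (hpos i)
    linarith
  have hsum : ∑ i, (x i - 1 - Real.log (x i)) = 0 := by
    apply le_antisymm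
    · simp only [Finset.sum_sub_distrib, hs]
      simp; exact hlog
    · exact Finset.sum_nonneg hnn
  have h := (Finset.sum_eq_zero_iff_of_nonneg hnn).1 hsum
  intro i
  by_contra hne
  have h1 := Real.log_lt_sub_one_of_pos (hpos i) hne
  have h2 := h i (Finset.mem_univ i)
  linarith

lemma gram_eq_one {n : ℕ} (B : Matrix (Fin n) (Fin n) ℝ) (hrow : ∀ i, (B * B.transpose) i i = 1)
    (hdet : 1 ≤ B.det ^ 2) : B * B.transpose = 1 := by
  have hps : (B * B.transpose).PosSemidef := by
    have := Matrix.posSemidef_self_mul_conjTranspose B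
    simpa using this
  have hH := hps.isHermitian
  have h1 : ∀ i, hH.eigenvalues i = 1 := by
    apply all_one
    · exact fun i => hps.eigenvalues_nonneg i
    · have := hH.trace_eq_sum_eigenvalues
      simp only [RCLike.ofReal_real_eq_id, id] at this
      rw [← this, Matrix.trace]
      simp [hrow]
    · have := hH.det_eq_prod_eigenvalues
      simp only [RCLike.ofReal_real_eq_id, id] at this
      rw [← this, Matrix.det_mul, Matrix.det_transpose, ← sq]
      exact hdet
  have h2 := hH.spectral_theorem
  have h3 : Matrix.diagonal ((RCLike.ofReal : ℝ → ℝ) ∘ hH.eigenvalues) = 1 := by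
    rw [← Matrix.diagonal_one]
    congr 1
    funext i
    simp [h1]
  rw [h3, map_one] at h2
  exact h2

/-- the weights -/
noncomputable def rr {d : ℕ} (P : Finset (Fin (d+2))) (i : Fin (d+2)) : ℝ :=
  if i ∈ P then √(((P.card : ℝ) - 1) / P.card) else √(((Pᶜ.card : ℝ) - 1) / Pᶜ.card)

/-- the normalized matrix -/
noncomputable def B {d : ℕ} (P : Finset (Fin (d+2))) (v : Fin (d+2) → EuclideanSpace ℝ (Fin d)) :
    Matrix (Fin (d+2)) (Fin (d+2)) ℝ :=
  Matrix.of fun i => Fin.cons (if i ∈ P then √(1 / (P.card : ℝ)) else 0)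
    (Fin.cons (if i ∈ P then 0 else √(1 / (Pᶜ.card : ℝ))) (fun k => rr P i * v i k))

/-- bound function -/
noncomputable def F (p : ℕ) : ℝ := (p : ℝ) ^ p / ((p : ℝ) - 1) ^ (p - 1)

lemma F_pos {p : ℕ} (hp : 2 ≤ p) : 0 < F p := by
  have : (2:ℝ) ≤ p := by exact_mod_cast hp
  unfold F
  have : (0:ℝ) < (p:ℝ) - 1 := by linarith
  positivity

lemma det_B {d : ℕ} (P : Finset (Fin (d+2))) (v : Fin (d+2) → EuclideanSpace ℝ (Fin d))
    (hp : 2 ≤ P.card) (hq : 2 ≤ Pᶜ.card) :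
    (B P v).det ^ 2 * (F P.card * F Pᶜ.card) = (∑ i ∈ P, lam v i) ^ 2 := by
  set p := P.card with hpd
  set q := Pᶜ.card with hqd
  have hp' : (2:ℝ) ≤ p := by exact_mod_cast hp
  have hq' : (2:ℝ) ≤ q := by exact_mod_cast hq
  have hp1 : (0:ℝ) < (p:ℝ) - 1 := by linarith
  have hq1 : (0:ℝ) < (q:ℝ) - 1 := by linarith
  set s : ℝ := √(1 / ((p:ℝ) - 1)) with hs
  set t : ℝ := √(1 / ((q:ℝ) - 1)) with ht
  have e1 : (N (fun i => if i ∈ P then 1 else 0) 1 v).det = ∑ i ∈ P, lam v i := by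
    rw [det_N_one]
    simp
  have e2 : (N (fun i => if i ∈ P then 1 else 0) (fun i => if i ∈ P then 0 else 1) v).det
      = ∑ i ∈ P, lam v i := by
    rw [← e1, ← Matrix.det_updateCol_add_smul_self (N (fun i => if i ∈ P then 1 else 0) 1 v)
      (i := 1) (j := 0) (by simp) (-1)]
    congr 1
    ext i j
    refine Fin.cases ?_ (fun j => Fin.cases ?_ (fun j => ?_) j) j
    · simp [N, Matrix.updateCol_apply]
    · by_cases h : i ∈ P <;> simp [N, Matrix.updateCol_apply, h]
    · simp [N, Matrix.updateCol_apply, Fin.ext_iff]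
  have e3 : B P v = Matrix.of fun i j => rr P i * (Matrix.of fun i j =>
      (Fin.cons s (Fin.cons t (fun _ => 1)) : Fin (d+2) → ℝ) j *
      N (fun i => if i ∈ P then 1 else 0) (fun i => if i ∈ P then 0 else 1) v i j) i j := by
    ext i j
    refine Fin.cases ?_ (fun j => Fin.cases ?_ (fun j => ?_) j) j
    · by_cases h : i ∈ P
      · simp [B, N, rr, h, hs, ← hpd]
        field_simp
      · simp [B, N, rr, h]
    · by_cases h : i ∈ P
      · simp [B, N, rr, h]
      · simp [B, N, rr, h, ht, ← hqd]
        field_simp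
    · simp [B, N]
  have e4 : (∏ i, rr P i) ^ 2 = (((p:ℝ) - 1) / p) ^ p * (((q:ℝ) - 1) / q) ^ q := by
    rw [← Finset.prod_pow, ← Finset.prod_mul_prod_compl P]
    congr 1
    · rw [Finset.prod_congr rfl (g := fun _ => ((p:ℝ) - 1) / p)]
      · simp [hpd, div_pow]
      · intro i hi
        rw [rr, if_pos hi, Real.sq_sqrt (by positivity)]
    · rw [Finset.prod_congr rfl (g := fun _ => ((q:ℝ) - 1) / q)]
      · simp [hqd, div_pow]
      · intro i hi
        rw [rr, if_neg (by simpa using hi), Real.sq_sqrt (by positivity)]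
  have e5 : ∏ i, (Fin.cons s (Fin.cons t (fun _ => 1)) : Fin (d+2) → ℝ) i = s * t := by
    simp [Fin.prod_univ_succ]
  rw [e3, Matrix.det_mul_column, Matrix.det_mul_row, e5, e2]
  have hs2 : s ^ 2 = 1 / ((p:ℝ) - 1) := Real.sq_sqrt (by positivity)
  have ht2 : t ^ 2 = 1 / ((q:ℝ) - 1) := Real.sq_sqrt (by positivity)
  have : (1 / ((p:ℝ) - 1)) * (((p:ℝ) - 1) / p) ^ p * F p = 1 := by
    obtain ⟨k, hk⟩ : ∃ k, p = k + 1 := ⟨p - 1, by omega⟩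
    rw [F, show p - 1 = k by omega, div_pow]
    conv_lhs => rw [show ((p:ℝ) - 1) ^ p = ((p:ℝ) - 1) ^ k * ((p:ℝ) - 1) by rw [← pow_succ, ← hk]]
    have : (p:ℝ) ^ p ≠ 0 := by positivity
    field_simp
  have h2 : (1 / ((q:ℝ) - 1)) * (((q:ℝ) - 1) / q) ^ q * F q = 1 := by
    obtain ⟨k, hk⟩ : ∃ k, q = k + 1 := ⟨q - 1, by omega⟩
    rw [F, show q - 1 = k by omega, div_pow]
    conv_lhs => rw [show ((q:ℝ) - 1) ^ q = ((q:ℝ) - 1) ^ k * ((q:ℝ) - 1) by rw [← pow_succ, ← hk]]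
    have : (q:ℝ) ^ q ≠ 0 := by positivity
    field_simp
  calc _ = (∏ i, rr P i)^2 * s^2 * t^2 * (F p * F q) * (∑ i ∈ P, lam v i) ^ 2 := by ring
    _ = ((1 / ((p:ℝ) - 1)) * (((p:ℝ) - 1) / p) ^ p * F p) *
        ((1 / ((q:ℝ) - 1)) * (((q:ℝ) - 1) / q) ^ q * F q) * (∑ i ∈ P, lam v i) ^ 2 := by
        rw [e4, hs2, ht2]; ring
    _ = _ := by rw [this, h2]; ring

lemma BBt {d : ℕ} (P : Finset (Fin (d+2))) (v : Fin (d+2) → EuclideanSpace ℝ (Fin d))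
    (i j : Fin (d+2)) :
    (B P v * (B P v).transpose) i j = (if i ∈ P ∧ j ∈ P then 1 / (P.card : ℝ) else 0) +
      (if i ∉ P ∧ j ∉ P then 1 / (Pᶜ.card : ℝ) else 0) + rr P i * rr P j * ⟪v i, v j⟫ := by
  rw [Matrix.mul_apply, Fin.sum_univ_succ, Fin.sum_univ_succ]
  have : ∑ k : Fin d, B P v i k.succ.succ * (B P v).transpose k.succ.succ j
      = rr P i * rr P j * ⟪v i, v j⟫ := by
    rw [PiLp.inner_apply, Finset.mul_sum]
    apply Finset.sum_congr rfl
    intro k _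
    simp [B]; ring
  rw [this, ← add_assoc]
  congr 1
  congr 1
  · by_cases hi : i ∈ P <;> by_cases hj : j ∈ P <;> simp [B, hi, hj, ← mul_inv]
  · by_cases hi : i ∈ P <;> by_cases hj : j ∈ P <;> simp [B, hi, hj, ← mul_inv]

lemma rr_sq {d : ℕ} (P : Finset (Fin (d+2))) (hp : 2 ≤ P.card) (hq : 2 ≤ Pᶜ.card)
    (i : Fin (d+2)) : rr P i * rr P i =
      if i ∈ P then ((P.card : ℝ) - 1) / P.card else ((Pᶜ.card : ℝ) - 1) / Pᶜ.card := by
  have hp' : (2:ℝ) ≤ P.card := by exact_mod_cast hp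
  have hq' : (2:ℝ) ≤ Pᶜ.card := by exact_mod_cast hq
  unfold rr
  split_ifs
  · exact Real.mul_self_sqrt (div_nonneg (by linarith) (by linarith))
  · exact Real.mul_self_sqrt (div_nonneg (by linarith) (by linarith))

lemma rr_pos {d : ℕ} (P : Finset (Fin (d+2))) (hp : 2 ≤ P.card) (hq : 2 ≤ Pᶜ.card)
    (i : Fin (d+2)) : 0 < rr P i := by
  have hp' : (2:ℝ) ≤ P.card := by exact_mod_cast hp
  have hq' : (2:ℝ) ≤ Pᶜ.card := by exact_mod_cast hq
  unfold rr
  split_ifs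
  · exact Real.sqrt_pos.2 (div_pos (by linarith) (by linarith))
  · exact Real.sqrt_pos.2 (div_pos (by linarith) (by linarith))

lemma BBt_diag {d : ℕ} (P : Finset (Fin (d+2))) (v : Fin (d+2) → EuclideanSpace ℝ (Fin d))
    (hp : 2 ≤ P.card) (hq : 2 ≤ Pᶜ.card) (hv : ∀ i, ‖v i‖ = 1)
    (i : Fin (d+2)) : (B P v * (B P v).transpose) i i = 1 := by
  have hp' : (2:ℝ) ≤ P.card := by exact_mod_cast hp
  have hq' : (2:ℝ) ≤ Pᶜ.card := by exact_mod_cast hq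
  rw [BBt, rr_sq P hp hq, real_inner_self_eq_norm_sq, hv]
  by_cases h : i ∈ P
  · simp only [h]; simp; field_simp; ring
  · simp only [h]; simp; field_simp; ring

/-- orthogonality gives the prescribed inner products -/
lemma inner_of {d : ℕ} (P : Finset (Fin (d+2))) (v : Fin (d+2) → EuclideanSpace ℝ (Fin d))
    (hp : 2 ≤ P.card) (hq : 2 ≤ Pᶜ.card) (h : B P v * (B P v).transpose = 1)
    (i j : Fin (d+2)) (hij : i ≠ j) :
    ⟪v i, v j⟫ = (if i ∈ P ∧ j ∈ P then -(1 / ((P.card : ℝ) - 1)) else 0) +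
      (if i ∉ P ∧ j ∉ P then -(1 / ((Pᶜ.card : ℝ) - 1)) else 0) := by
  have hp' : (2:ℝ) ≤ P.card := by exact_mod_cast hp
  have hq' : (2:ℝ) ≤ Pᶜ.card := by exact_mod_cast hq
  have h1 := BBt P v i j
  rw [h, Matrix.one_apply_ne hij] at h1
  have hii := rr_sq P hp hq i
  have ri := rr_pos P hp hq i
  have rj := rr_pos P hp hq j
  have hp1 : (0:ℝ) < (P.card:ℝ) - 1 := by linarith
  have hq1 : (0:ℝ) < (Pᶜ.card:ℝ) - 1 := by linarith
  by_cases hi : i ∈ P <;> by_cases hj : j ∈ P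
  · have : rr P j = rr P i := by simp [rr, hi, hj]
    rw [this, hii] at h1
    simp only [hi, hj] at h1 ⊢
    simp at h1 ⊢
    field_simp at h1 ⊢
    linarith
  · simp only [hi, hj] at h1 ⊢
    simp [ri.ne', rj.ne'] at h1 ⊢
    exact h1
  · simp only [hi, hj] at h1 ⊢
    simp [ri.ne', rj.ne'] at h1 ⊢
    exact h1
  · have : rr P j = rr P i := by simp [rr, hi, hj]
    rw [this, hii] at h1
    simp only [hi, hj] at h1 ⊢
    simp at h1 ⊢
    field_simp at h1 ⊢
    linarith

lemma exists_opt {d : ℕ} (P : Finset (Fin (d+2))) (hp : 2 ≤ P.card) (hq : 2 ≤ Pᶜ.card) :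
    ∃ w : Fin (d+2) → EuclideanSpace ℝ (Fin d), B P w * (B P w).transpose = 1 := by
  have hp' : (2:ℝ) ≤ P.card := by exact_mod_cast hp
  have hq' : (2:ℝ) ≤ Pᶜ.card := by exact_mod_cast hq
  set a : EuclideanSpace ℝ (Fin (d+2)) :=
    WithLp.toLp 2 (fun i => if i ∈ P then √(1 / (P.card : ℝ)) else 0) with ha
  set b : EuclideanSpace ℝ (Fin (d+2)) :=
    WithLp.toLp 2 (fun i => if i ∈ P then 0 else √(1 / (Pᶜ.card : ℝ))) with hb
  set f : Fin (d+2) → EuclideanSpace ℝ (Fin (d+2)) := Fin.cons a (Fin.cons b (fun _ => 0)) with hf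
  have haa : ⟪a, a⟫ = 1 := by
    rw [PiLp.inner_apply]
    simp [ha, ← mul_inv, ← Finset.sum_filter]
    field_simp
  have hbb : ⟪b, b⟫ = 1 := by
    rw [PiLp.inner_apply]
    have : ∀ i, inner ℝ (b i) (b i) = if i ∈ Pᶜ then 1 / (Pᶜ.card : ℝ) else 0 := by
      intro i
      by_cases h : i ∈ P <;> simp [hb, h, ← mul_inv]
    simp only [this, Finset.sum_ite_mem, Finset.univ_inter, Finset.sum_const, nsmul_eq_mul]
    field_simp
  have hab : ⟪a, b⟫ = 0 := by
    rw [PiLp.inner_apply]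
    apply Finset.sum_eq_zero
    intro i _
    by_cases h : i ∈ P <;> simp [ha, hb, h]
  have hort : Orthonormal ℝ (({0, 1} : Set (Fin (d+2))).domRestrict f) := by
    rw [orthonormal_iff_ite]
    rintro ⟨i, rfl | rfl⟩ ⟨j, rfl | rfl⟩
    · simpa [hf] using haa
    · rw [if_neg (by simp [Subtype.ext_iff])]; simpa [hf] using hab
    · rw [if_neg (by simp [Subtype.ext_iff]), real_inner_comm]; simpa [hf] using hab
    · simpa [hf] using hbb
  obtain ⟨e, he⟩ := hort.exists_orthonormalBasis_extension_of_card_eq (by simp)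
  have he0 : e 0 = a := by rw [he 0 (by simp)]; simp [hf]
  have he1 : e 1 = b := by rw [he 1 (by simp)]; simp [hf]
  refine ⟨fun i => WithLp.toLp 2 (fun k => e k.succ.succ i / rr P i), ?_⟩
  set w : Fin (d+2) → EuclideanSpace ℝ (Fin d) :=
    fun i => WithLp.toLp 2 (fun k => e k.succ.succ i / rr P i) with hw
  have hB : ∀ i k, B P w i k = e k i := by
    intro i k
    refine Fin.cases ?_ (fun j => Fin.cases ?_ (fun j => ?_) j) k
    · rw [he0]; simp [B, ha]
    · rw [show Fin.succ (0 : Fin (d+1)) = 1 from rfl, he1]; simp [B, hb]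
    · have := (rr_pos P hp hq i).ne'
      simp [B, hw]; field_simp
  rw [mul_eq_one_comm]
  ext k l
  rw [Matrix.mul_apply]
  simp only [Matrix.transpose_apply, hB]
  have := orthonormal_iff_ite.1 e.orthonormal l k
  rw [PiLp.inner_apply] at this
  simp only [Matrix.one_apply]
  simpa [eq_comm] using this

lemma norm_of {d : ℕ} (P : Finset (Fin (d+2))) (v : Fin (d+2) → EuclideanSpace ℝ (Fin d))
    (hp : 2 ≤ P.card) (hq : 2 ≤ Pᶜ.card) (h : B P v * (B P v).transpose = 1)
    (i : Fin (d+2)) : ‖v i‖ = 1 := by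
  have hp' : (2:ℝ) ≤ P.card := by exact_mod_cast hp
  have hq' : (2:ℝ) ≤ Pᶜ.card := by exact_mod_cast hq
  have hp1 : (0:ℝ) < (P.card:ℝ) - 1 := by linarith
  have hq1 : (0:ℝ) < (Pᶜ.card:ℝ) - 1 := by linarith
  have h1 := BBt P v i i
  rw [h, Matrix.one_apply_eq, rr_sq P hp hq, real_inner_self_eq_norm_sq] at h1
  have key : ∀ m y : ℝ, 0 < m - 1 → 1 = 1 / m + (m - 1) / m * y → y = 1 := by
    intro m y hm h
    have hm0 : m ≠ 0 := by linarith
    field_simp at h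
    have : (m - 1) * (y - 1) = 0 := by linarith
    rcases mul_eq_zero.1 this with h | h <;> linarith
  have : ‖v i‖ ^ 2 = 1 := by
    by_cases hi : i ∈ P
    · refine key _ _ hp1 ?_
      simpa [hi] using h1
    · refine key _ _ hq1 ?_
      rw [if_neg (by tauto), if_pos ⟨hi, hi⟩, if_neg hi, zero_add] at h1
      exact h1
  nlinarith [norm_nonneg (v i)]

lemma G_concave : StrictConcaveOn ℝ (Set.Ioi 1)
    (fun x : ℝ => x * Real.log x - (x - 1) * Real.log (x - 1)) := by
  have hd : ∀ x : ℝ, 1 < x → HasDerivAt (fun x : ℝ => x * Real.log x - (x - 1) * Real.log (x - 1))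
      (Real.log x - Real.log (x - 1)) x := by
    intro x hx
    have h1 := Real.hasDerivAt_mul_log (x := x) (by linarith)
    have h2 := (Real.hasDerivAt_mul_log (x := x - 1) (by linarith)).comp_sub_const x 1
    have := h1.sub h2
    have he : Real.log x - Real.log (x - 1) = (Real.log x + 1) - (Real.log (x - 1) + 1) := by ring
    rw [he]
    exact this
  apply StrictAntiOn.strictConcaveOn_of_deriv (convex_Ioi 1)
  · intro x hx
    exact (hd x hx).continuousAt.continuousWithinAt
  · rw [interior_Ioi]
    intro x hx y hy hxy
    simp only [Set.mem_Ioi] at hx hy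
    rw [(hd x hx).deriv, (hd y hy).deriv, ← Real.log_div (by linarith) (by linarith),
      ← Real.log_div (by linarith) (by linarith)]
    apply Real.log_lt_log (div_pos (by linarith) (by linarith))
    rw [div_lt_div_iff₀ (by linarith) (by linarith)]
    linarith

lemma log_F {p : ℕ} (hp : 2 ≤ p) :
    Real.log (F p) = (p:ℝ) * Real.log p - ((p:ℝ) - 1) * Real.log ((p:ℝ) - 1) := by
  have : (2:ℝ) ≤ p := by exact_mod_cast hp
  have h1 : (0:ℝ) < (p:ℝ) - 1 := by linarith
  rw [F, Real.log_div (by positivity) (by positivity), Real.log_pow, Real.log_pow]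
  rw [Nat.cast_sub (by omega)]
  simp

lemma F_lt {p q a b : ℕ} (hp : 2 ≤ p) (hpa : p < a) (hab : a ≤ b) (hs : p + q = a + b) :
    F p * F q < F a * F b := by
  have hbq : b < q := by omega
  have := F_pos hp
  have := F_pos (p := q) (by omega)
  have := F_pos (p := a) (by omega)
  have := F_pos (p := b) (by omega)
  rw [← Real.log_lt_log_iff (by positivity) (by positivity), Real.log_mul (by positivity) (by positivity),
    Real.log_mul (by positivity) (by positivity), log_F hp, log_F (by omega), log_F (by omega), log_F (by omega)]
  have hp' : (2:ℝ) ≤ p := by exact_mod_cast hp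
  have hpa' : (p:ℝ) < a := by exact_mod_cast hpa
  have hab' : (a:ℝ) ≤ b := by exact_mod_cast hab
  have hbq' : (b:ℝ) < q := by exact_mod_cast hbq
  have hs' : (p:ℝ) + q = a + b := by exact_mod_cast hs
  have hD : (0:ℝ) < q - p := by linarith
  have hx : (0:ℝ) < (q - a) / (q - p) := div_pos (by linarith) hD
  have hy : (0:ℝ) < (a - p) / (q - p) := div_pos (by linarith) hD
  have hxy : ((q:ℝ) - a) / (q - p) + (a - p) / (q - p) = 1 := by field_simp; ring
  have c1 := G_concave.2 (x := (p:ℝ)) (y := (q:ℝ)) (by simp; linarith) (by simp; linarith)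
    (by linarith) hx hy hxy
  have c2 := G_concave.2 (x := (p:ℝ)) (y := (q:ℝ)) (by simp; linarith) (by simp; linarith)
    (by linarith) hy hx (by linarith)
  have k1 : (((q:ℝ) - a) / (q - p)) • (p:ℝ) + (((a:ℝ) - p) / (q - p)) • (q:ℝ) = a := by
    simp only [smul_eq_mul]; field_simp; ring
  have k2 : (((a:ℝ) - p) / (q - p)) • (p:ℝ) + (((q:ℝ) - a) / (q - p)) • (q:ℝ) = b := by
    simp only [smul_eq_mul]
    rw [show (b:ℝ) = p + q - a by linarith]
    field_simp; ring
  rw [k1] at c1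
  rw [k2] at c2
  simp only [smul_eq_mul] at c1 c2
  set gp := (p:ℝ) * Real.log p - ((p:ℝ) - 1) * Real.log ((p:ℝ) - 1)
  set gq := (q:ℝ) * Real.log q - ((q:ℝ) - 1) * Real.log ((q:ℝ) - 1)
  set X := ((q:ℝ) - a) / (q - p)
  set Y := ((a:ℝ) - p) / (q - p)
  have : Y = 1 - X := by linarith
  rw [this] at c1 c2
  linarith

/-- sign lemma -/
lemma lam_zero {d : ℕ} (v : Fin (d+2) → EuclideanSpace ℝ (Fin d)) (hinj : Function.Injective v)
    (hv : ∀ i, ‖v i‖ = 1) (σ : ℝ) (hσ : σ ≠ 0) (i : Fin (d+2))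
    (h : ∀ j, j ≠ i → 0 ≤ σ * lam v j) : ∀ j, lam v j = 0 := by
  have hlt : ∀ j, j ≠ i → ⟪v j, v i⟫ < 1 := by
    intro j hj
    exact inner_lt_one_iff_real_of_norm_eq_one (hv j) (hv i) |>.2 (hinj.ne hj)
  have hsum : ∑ j, σ * lam v j * (1 - ⟪v j, v i⟫) = 0 := by
    have h1 : ∑ j, lam v j * ⟪v j, v i⟫ = 0 := by
      have := congrArg (fun x => ⟪x, v i⟫) (sum_lam_smul v)
      simpa [sum_inner, inner_smul_left] using this
    calc _ = σ * (∑ j, lam v j) - σ * ∑ j, lam v j * ⟪v j, v i⟫ := by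
          rw [Finset.mul_sum, Finset.mul_sum, ← Finset.sum_sub_distrib]
          apply Finset.sum_congr rfl; intros; ring
      _ = 0 := by rw [h1, sum_lam]; simp
  have hz := (Finset.sum_eq_zero_iff_of_nonneg (by
    intro j _
    by_cases hj : j = i
    · subst hj; simp [real_inner_self_eq_norm_sq, hv]
    · exact mul_nonneg (h j hj) (by linarith [hlt j hj]))).1 hsum
  have hne : ∀ j, j ≠ i → lam v j = 0 := by
    intro j hj
    have := hz j (Finset.mem_univ j)
    rcases mul_eq_zero.1 this with h1 | h1
    · exact (mul_eq_zero.1 h1).resolve_left hσ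
    · linarith [hlt j hj]
  intro j
  by_cases hj : j = i
  · subst hj
    have := sum_lam v
    rwa [Finset.sum_eq_single j (fun k _ hk => hne k hk) (by simp)] at this
  · exact hne j hj

lemma abs_sum_le {d : ℕ} (v : Fin (d+2) → EuclideanSpace ℝ (Fin d)) (P : Finset (Fin (d+2))) :
    |∑ i ∈ P, lam v i| ≤ ∑ i ∈ pos v, lam v i := by
  have key : ∀ Q : Finset (Fin (d+2)), ∑ i ∈ Q, lam v i ≤ ∑ i ∈ pos v, lam v i := by
    intro Q
    rw [pos, Finset.sum_filter]
    calc ∑ i ∈ Q, lam v i ≤ ∑ i ∈ Q, (if 0 < lam v i then lam v i else 0) := by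
          apply Finset.sum_le_sum
          intro i _
          split_ifs with h <;> linarith
      _ ≤ _ := by
          apply Finset.sum_le_sum_of_subset_of_nonneg (Finset.subset_univ _)
          intro i _ _
          split_ifs with h <;> linarith
  rw [abs_le]
  refine ⟨?_, key P⟩
  have := key Pᶜ
  have h2 := Finset.sum_add_sum_compl P (lam v)
  rw [sum_lam] at h2
  linarith

end MaxVol

theorem max_volume_d_plus_2_structure (d : ℕ) (hd : 2 ≤ d)
    (V : Finset (EuclideanSpace ℝ (Fin d)))
    (hVsph : (V : Set (EuclideanSpace ℝ (Fin d))) ⊆ Metric.sphere 0 1)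
    (hVcard : V.card = d + 2)
    (hmax : ∀ W : Finset (EuclideanSpace ℝ (Fin d)),
      (W : Set (EuclideanSpace ℝ (Fin d))) ⊆ Metric.sphere 0 1 → W.card = d + 2 →
      volume (convexHull ℝ (W : Set (EuclideanSpace ℝ (Fin d)))) ≤
        volume (convexHull ℝ (V : Set (EuclideanSpace ℝ (Fin d))))) :
    ∃ V₁ V₂ : Finset (EuclideanSpace ℝ (Fin d)),
      V₁ ∪ V₂ = V ∧ Disjoint V₁ V₂ ∧
      V₁.card = d / 2 + 1 ∧ V₂.card = (d + 1) / 2 + 1 ∧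
      (∀ u ∈ V₁, ∀ v ∈ V₁, u ≠ v → ⟪u, v⟫ = -(1 / ((d / 2 : ℕ) : ℝ))) ∧
      (∀ u ∈ V₂, ∀ v ∈ V₂, u ≠ v → ⟪u, v⟫ = -(1 / (((d + 1) / 2 : ℕ) : ℝ))) ∧
      (∀ u ∈ V₁, ∀ v ∈ V₂, ⟪u, v⟫ = 0) := by
  -- index the points of `V`
  obtain ⟨v, hinj, hrange⟩ : ∃ v : Fin (d+2) → EuclideanSpace ℝ (Fin d),
      Function.Injective v ∧ Finset.univ.image v = V := by
    let e := (V.equivFinOfCardEq hVcard).symm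
    refine ⟨fun i => (e i : EuclideanSpace ℝ (Fin d)),
      Subtype.val_injective.comp e.injective, ?_⟩
    ext x
    simp only [Finset.mem_image, Finset.mem_univ, true_and]
    constructor
    · rintro ⟨i, rfl⟩; exact (e i).2
    · intro hx; exact ⟨e.symm ⟨x, hx⟩, by simp⟩
  have hVr : (V : Set (EuclideanSpace ℝ (Fin d))) = Set.range v := by
    rw [← hrange]; simp
  have hv : ∀ i, ‖v i‖ = 1 := by
    intro i
    have : v i ∈ (V : Set (EuclideanSpace ℝ (Fin d))) := by rw [hVr]; exact ⟨i, rfl⟩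
    simpa using hVsph this
  -- the competitor
  obtain ⟨P₀, _, hP₀⟩ := Finset.exists_subset_card_eq (s := (Finset.univ : Finset (Fin (d+2))))
    (n := d / 2 + 1) (by simp; omega)
  have hP₀c : P₀ᶜ.card = (d + 1) / 2 + 1 := by
    rw [Finset.card_compl, hP₀]; simp; omega
  have h2p : 2 ≤ P₀.card := by omega
  have h2q : 2 ≤ P₀ᶜ.card := by omega
  obtain ⟨w, hw⟩ := MaxVol.exists_opt P₀ h2p h2q
  have hwn := MaxVol.norm_of P₀ w h2p h2q hw
  have hwinj : Function.Injective w := by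
    intro i j hij
    by_contra hne
    have h1 := MaxVol.inner_of P₀ w h2p h2q hw i j hne
    rw [hij, real_inner_self_eq_norm_sq, hwn] at h1
    have a1 : (2:ℝ) ≤ P₀.card := by exact_mod_cast h2p
    have a2 : (2:ℝ) ≤ P₀ᶜ.card := by exact_mod_cast h2q
    have b1 : (0:ℝ) < 1 / ((P₀.card:ℝ) - 1) := div_pos one_pos (by linarith)
    have b2 : (0:ℝ) < 1 / ((P₀ᶜ.card:ℝ) - 1) := div_pos one_pos (by linarith)
    split_ifs at h1 <;> linarith
  have hcmp := hmax (Finset.univ.image w) (by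
      intro x hx
      simp only [Finset.coe_image, Finset.coe_univ, Set.image_univ, Set.mem_range] at hx
      obtain ⟨i, rfl⟩ := hx
      simp [hwn]) (by rw [Finset.card_image_of_injective _ hwinj]; simp)
  have hcmp2 : ∑ i ∈ MaxVol.pos w, MaxVol.lam w i ≤ ∑ i ∈ MaxVol.pos v, MaxVol.lam v i := by
    have h1 := MaxVol.vol_ge w
    have h2 := MaxVol.vol_le v
    rw [hVr, Finset.coe_image, Finset.coe_univ, Set.image_univ] at hcmp
    have h3 := (h1.trans hcmp).trans h2
    rw [ENNReal.mul_le_mul_iff_left (MaxVol.C_ne_zero d) (MaxVol.C_ne_top d)] at h3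
    rwa [ENNReal.ofReal_le_ofReal_iff] at h3
    apply Finset.sum_nonneg
    intro i hi
    simp [MaxVol.pos] at hi
    exact hi.le
  have hdetw := MaxVol.det_B P₀ w h2p h2q
  have hdw : (MaxVol.B P₀ w).det ^ 2 = 1 := by
    have := congrArg Matrix.det hw
    rw [Matrix.det_mul, Matrix.det_transpose, Matrix.det_one] at this
    rw [sq, this]
  rw [hdw, one_mul] at hdetw
  have hF1 := MaxVol.F_pos h2p
  have hF2 := MaxVol.F_pos h2q
  set P := MaxVol.pos v with hP
  have hge : MaxVol.F P₀.card * MaxVol.F P₀ᶜ.card ≤ (∑ i ∈ P, MaxVol.lam v i) ^ 2 := by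
    rw [hdetw, ← sq_abs]
    exact pow_le_pow_left₀ (abs_nonneg _) ((MaxVol.abs_sum_le w P₀).trans hcmp2) 2
  have hnz : ¬ ∀ j, MaxVol.lam v j = 0 := by
    intro h
    simp only [h] at hge
    simp at hge
    have := mul_pos hF1 hF2
    linarith
  have hp : 2 ≤ P.card := by
    by_contra hlt
    obtain ⟨i, hi⟩ := Finset.card_le_one_iff_subset_singleton.1 (show P.card ≤ 1 by omega)
    refine hnz (MaxVol.lam_zero v hinj hv (-1) (by norm_num) i ?_)
    intro j hj
    have : j ∉ P := fun h => hj (by simpa using hi h)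
    simp [hP, MaxVol.pos] at this
    linarith
  have hq : 2 ≤ Pᶜ.card := by
    by_contra hlt
    obtain ⟨i, hi⟩ := Finset.card_le_one_iff_subset_singleton.1 (show Pᶜ.card ≤ 1 by omega)
    refine hnz (MaxVol.lam_zero v hinj hv 1 (by norm_num) i ?_)
    intro j hj
    have : j ∈ P := by
      by_contra h
      exact hj (by simpa using hi (Finset.mem_compl.2 h))
    simp [hP, MaxVol.pos] at this
    linarith
  have hdetv := MaxVol.det_B P v hp hq
  have hG1 := MaxVol.F_pos hp
  have hG2 := MaxVol.F_pos hq
  have hpq : P.card + Pᶜ.card = d + 2 := by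
    rw [Finset.card_add_card_compl]; simp
  -- the extremal inequality
  have hcases : (P.card = d / 2 + 1 ∧ Pᶜ.card = (d + 1) / 2 + 1) ∨
      (Pᶜ.card = d / 2 + 1 ∧ P.card = (d + 1) / 2 + 1) ∨
      MaxVol.F P.card * MaxVol.F Pᶜ.card < MaxVol.F P₀.card * MaxVol.F P₀ᶜ.card := by
    rw [hP₀, hP₀c]
    rcases lt_trichotomy P.card (d / 2 + 1) with h | h | h
    · right; right
      exact MaxVol.F_lt hp h (by omega) (by omega)
    · left; omega
    · rcases lt_or_ge Pᶜ.card (d / 2 + 1) with h' | h'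
      · right; right
        rw [mul_comm]
        exact MaxVol.F_lt hq h' (by omega) (by omega)
      · right; left; omega
  have hle : MaxVol.F P.card * MaxVol.F Pᶜ.card ≤ MaxVol.F P₀.card * MaxVol.F P₀ᶜ.card := by
    rcases hcases with ⟨h1, h2⟩ | ⟨h1, h2⟩ | h
    · rw [h1, h2, hP₀, hP₀c]
    · rw [h1, h2, hP₀, hP₀c, mul_comm]
    · exact h.le
  have hone : 1 ≤ (MaxVol.B P v).det ^ 2 := by
    have hpos := mul_pos hG1 hG2
    by_contra hlt
    push Not at hlt
    have := mul_lt_mul_of_pos_right hlt hpos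
    linarith
  have hgram := MaxVol.gram_eq_one _ (MaxVol.BBt_diag P v hp hq hv) hone
  have hdv : (MaxVol.B P v).det ^ 2 = 1 := by
    have := congrArg Matrix.det hgram
    rw [Matrix.det_mul, Matrix.det_transpose, Matrix.det_one] at this
    rw [sq, this]
  rw [hdv, one_mul] at hdetv
  have hin := MaxVol.inner_of P v hp hq hgram
  have hun : P.image v ∪ Pᶜ.image v = V := by
    rw [← Finset.image_union, Finset.union_compl, hrange]
  have hdis : Disjoint (P.image v) (Pᶜ.image v) :=
    (Finset.disjoint_image hinj).2 disjoint_compl_right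
  have hc1 : (P.image v).card = P.card := Finset.card_image_of_injective _ hinj
  have hc2 : (Pᶜ.image v).card = Pᶜ.card := Finset.card_image_of_injective _ hinj
  have i1 : ∀ x ∈ P.image v, ∀ y ∈ P.image v, x ≠ y → ⟪x, y⟫ = -(1 / ((P.card : ℝ) - 1)) := by
    intro x hx y hy hxy
    obtain ⟨i, hi, rfl⟩ := Finset.mem_image.1 hx
    obtain ⟨j, hj, rfl⟩ := Finset.mem_image.1 hy
    rw [hin i j (fun h => hxy (by rw [h]))]
    simp [hi, hj]
  have i2 : ∀ x ∈ Pᶜ.image v, ∀ y ∈ Pᶜ.image v, x ≠ y →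
      ⟪x, y⟫ = -(1 / ((Pᶜ.card : ℝ) - 1)) := by
    intro x hx y hy hxy
    obtain ⟨i, hi, rfl⟩ := Finset.mem_image.1 hx
    obtain ⟨j, hj, rfl⟩ := Finset.mem_image.1 hy
    rw [hin i j (fun h => hxy (by rw [h]))]
    rw [Finset.mem_compl] at hi hj
    rw [if_neg (by tauto), if_pos ⟨hi, hj⟩, zero_add]
  have i3 : ∀ x ∈ P.image v, ∀ y ∈ Pᶜ.image v, ⟪x, y⟫ = 0 := by
    intro x hx y hy
    obtain ⟨i, hi, rfl⟩ := Finset.mem_image.1 hx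
    obtain ⟨j, hj, rfl⟩ := Finset.mem_image.1 hy
    rw [Finset.mem_compl] at hj
    rw [hin i j (by rintro rfl; exact hj hi)]
    rw [if_neg (by tauto), if_neg (by tauto), zero_add]
  rcases hcases with ⟨h1, h2⟩ | ⟨h1, h2⟩ | h
  · refine ⟨P.image v, Pᶜ.image v, hun, hdis, by rw [hc1, h1], by rw [hc2, h2], ?_, ?_, i3⟩
    · intro x hx y hy hxy
      rw [i1 x hx y hy hxy, h1]; push_cast; ring
    · intro x hx y hy hxy
      rw [i2 x hx y hy hxy, h2]; push_cast; ring
  · refine ⟨Pᶜ.image v, P.image v, by rw [Finset.union_comm, hun], hdis.symm,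
      by rw [hc2, h1], by rw [hc1, h2], ?_, ?_, ?_⟩
    · intro x hx y hy hxy
      rw [i2 x hx y hy hxy, h1]; push_cast; ring
    · intro x hx y hy hxy
      rw [i1 x hx y hy hxy, h2]; push_cast; ring
    · intro x hx y hy
      rw [real_inner_comm]; exact i3 y hy x hx
  · linarith
end

section
/- Let d ≥ 1 be an integer. Then for every finite set V ⊂ S^{d-1} with exactly d+1 elements one has vol(conv V) ≤ (d+1)^{(d+1)/2} / (d^{d/2} · d!); equality is attained, and if V attains equality then ⟨u,v⟩ = −1/d for all distinct u,v ∈ V, i.e. V is the vertex set of a regular d-simplex inscribed in S^{d-1}. -/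
open MeasureTheory Real RealInnerProductSpace

lemma hadamard_psd {n : ℕ} (G : Matrix (Fin n) (Fin n) ℝ) (hG : G.PosSemidef) (a : ℝ) (ha : 0 < a)
    (hd : ∀ i, G i i = a) :
    G.det ≤ a ^ n ∧ (G.det = a ^ n → G = a • (1 : Matrix (Fin n) (Fin n) ℝ)) := by
  have hH := hG.isHermitian
  set e := hH.eigenvalues with he
  have hdet : G.det = ∏ i, e i := by simpa using hH.det_eq_prod_eigenvalues
  have htr : ∑ i, e i = n * a := by
    have := hH.trace_eq_sum_eigenvalues
    simp [Matrix.trace, hd] at this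
    simpa using this.symm
  have h0 : ∀ i, 0 ≤ e i := hG.eigenvalues_nonneg
  have hexp : ∏ i, a * Real.exp (e i / a - 1) = a ^ n := by
    rw [Finset.prod_mul_distrib, ← Real.exp_sum]
    simp [← Finset.sum_div, htr, ha.ne']
  have hle : ∀ i, e i ≤ a * Real.exp (e i / a - 1) := fun i => by
    have := Real.add_one_le_exp (e i / a - 1)
    calc e i = a * (e i / a - 1 + 1) := by field_simp; ring
      _ ≤ _ := by gcongr
  refine ⟨?_, ?_⟩
  · rw [hdet, ← hexp]
    exact Finset.prod_le_prod (fun i _ => h0 i) (fun i _ => hle i)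
  · intro heq
    have hpos : ∀ i, 0 < e i := by
      intro i
      refine lt_of_le_of_ne (h0 i) fun h => ?_
      have : G.det = 0 := by rw [hdet]; exact Finset.prod_eq_zero (Finset.mem_univ i) h.symm
      rw [this] at heq
      exact (pow_pos ha n).ne heq
    have hall : ∀ i, e i = a := by
      by_contra! hne
      obtain ⟨i, hi⟩ := hne
      have : ∏ i, e i < ∏ i, a * Real.exp (e i / a - 1) := by
        refine Finset.prod_lt_prod (fun i _ => hpos i) (fun i _ => hle i) ⟨i, Finset.mem_univ _, ?_⟩
        have h1 : e i / a - 1 ≠ 0 := by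
          intro h; apply hi; field_simp at h; linarith
        have := Real.add_one_lt_exp h1
        calc e i = a * (e i / a - 1 + 1) := by field_simp; ring
          _ < _ := by gcongr
      rw [hexp, ← hdet, heq] at this
      exact lt_irrefl _ this
    have hs := hH.spectral_theorem
    have : (RCLike.ofReal ∘ hH.eigenvalues : Fin n → ℝ) = fun _ => a := by
      funext i; simpa using hall i
    rw [this] at hs
    have h2 : (Matrix.diagonal fun _ : Fin n => a) = algebraMap ℝ (Matrix (Fin n) (Fin n) ℝ) a := by
      rw [Matrix.algebraMap_eq_diagonal]; rfl
    rw [hs, Matrix.smul_one_eq_diagonal, h2]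
    simp [Unitary.conjStarAlgAut_apply, Algebra.algebraMap_eq_smul_one]

lemma vol_corner (n : ℕ) : ∀ t : ℝ, 0 ≤ t →
    volume {x : Fin n → ℝ | (∀ i, 0 ≤ x i) ∧ ∑ i, x i ≤ t} = ENNReal.ofReal (t ^ n / n.factorial) := by
  induction n with
  | zero => 
    intro t ht
    simp [ht, volume_pi]
  | succ n ih =>
    intro t ht
    have hmp := (volume_preserving_piFinSuccAbove (fun _ : Fin (n+1) => ℝ) 0).symm
    have hm : ∀ k (t : ℝ), MeasurableSet {x : Fin k → ℝ | (∀ i, 0 ≤ x i) ∧ ∑ i, x i ≤ t} := by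
      intro k t
      apply MeasurableSet.inter
      · show MeasurableSet {x : Fin k → ℝ | (∀ i, 0 ≤ x i)}
        rw [Set.ofPred_forall]
        exact MeasurableSet.iInter fun i => measurableSet_le measurable_const (measurable_pi_apply i)
      · show MeasurableSet {x : Fin k → ℝ | ∑ i, x i ≤ t}
        exact measurableSet_le (by fun_prop) measurable_const
    rw [← hmp.measure_preimage (hm _ t).nullMeasurableSet]
    rw [Measure.volume_eq_prod, Measure.prod_apply (hmp.measurable (hm _ t))]
    have hsl : ∀ x : ℝ, volume (Prod.mk x ⁻¹' (⇑(MeasurableEquiv.piFinSuccAbove (fun _ : Fin (n+1) => ℝ) 0).symm ⁻¹'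
        {x : Fin (n+1) → ℝ | (∀ i, 0 ≤ x i) ∧ ∑ i, x i ≤ t})) =
        (Set.Icc 0 t).indicator (fun x => ENNReal.ofReal ((t - x) ^ n / n.factorial)) x := by
      intro x
      by_cases hx : x ∈ Set.Icc 0 t
      · rw [Set.indicator_of_mem hx, ← ih (t - x) (by linarith [hx.2])]
        congr 1
        ext y
        simp [MeasurableEquiv.piFinSuccAbove, Fin.forall_fin_succ, Fin.sum_univ_succ, hx.1, le_sub_iff_add_le']
      · rw [Set.indicator_of_notMem hx, ← measure_empty (μ := (volume : Measure (Fin n → ℝ)))]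
        congr 1
        ext y
        simp only [MeasurableEquiv.piFinSuccAbove, Fin.forall_fin_succ, Fin.sum_univ_succ, Set.mem_preimage, Set.mem_ofPred_eq, Set.mem_empty_iff_false, iff_false]
        simp
        intro h0 hy
        by_contra! h
        have : 0 ≤ ∑ i, y i := Finset.sum_nonneg fun i _ => hy i
        exact hx ⟨h0, by linarith⟩
    simp_rw [hsl]
    rw [lintegral_indicator measurableSet_Icc, ← ofReal_integral_eq_lintegral_ofReal]
    · congr 1
      rw [integral_Icc_eq_integral_Ioc, ← intervalIntegral.integral_of_le ht]
      rw [intervalIntegral.integral_div, intervalIntegral.integral_comp_sub_left (fun x => x ^ n)]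
      simp [Nat.factorial_succ]
      field_simp
    · exact (Continuous.integrableOn_Icc (by fun_prop))
    · refine (ae_restrict_iff' measurableSet_Icc).2 (Filter.Eventually.of_forall fun x hx => ?_)
      have : 0 ≤ t - x := by linarith [hx.2]
      positivity

lemma simplex_vol {d : ℕ} (v : Fin (d + 1) → EuclideanSpace ℝ (Fin d)) :
    (volume (convexHull ℝ (Set.range v))).toReal =
      |(Matrix.of fun i j : Fin d => v i.succ j - v 0 j).det| / d.factorial := by
  set D := (Matrix.of fun i j : Fin d => v i.succ j - v 0 j) with hD
  set S : Set (Fin d → ℝ) := {x | (∀ i, 0 ≤ x i) ∧ ∑ i, x i ≤ 1} with hS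
  have himg : convexHull ℝ (Set.range v) =
      (fun x => v 0 + x) '' ((Matrix.toLpLin 2 2 D.transpose) '' (WithLp.ofLp ⁻¹' S)) := by
    have h1 : convexHull ℝ (Set.range v) = (fun w : Fin (d+1) → ℝ => ∑ i, w i • v i) '' stdSimplex ℝ (Fin (d+1)) := by
      have hlin : (fun w : Fin (d+1) → ℝ => ∑ i, w i • v i) = ⇑(∑ i, (LinearMap.proj (R := ℝ) (φ := fun _ : Fin (d+1) => ℝ) i).smulRight (v i)) := by
        ext w; simp
      rw [hlin, ← convexHull_basis_eq_stdSimplex, LinearMap.image_convexHull, ← Set.range_comp]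
      congr 2
      ext i
      simp
    have key : ∀ (x : Fin d → ℝ), v 0 + Matrix.toLpLin 2 2 D.transpose (WithLp.toLp 2 x) = (1 - ∑ i, x i) • v 0 + ∑ i, x i • v i.succ := by
      intro x
      ext j
      simp [Matrix.mulVec, dotProduct, hD, sub_mul, Finset.sum_mul, mul_comm]
      simp only [mul_sub, Finset.sum_sub_distrib]
      ring
    rw [h1]
    ext p
    constructor
    · rintro ⟨w, ⟨hw0, hw1⟩, rfl⟩
      rw [Fin.sum_univ_succ] at hw1
      refine ⟨_, ⟨WithLp.toLp 2 (fun i => w i.succ), ⟨fun i => hw0 _, ?_⟩, rfl⟩, ?_⟩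
      · have := hw0 0
        show ∑ i : Fin d, w i.succ ≤ 1
        linarith
      · simp only [key]
        rw [Fin.sum_univ_succ, ← hw1]
        simp
    · rintro ⟨_, ⟨x, ⟨hx0, hx1⟩, rfl⟩, rfl⟩
      refine ⟨Fin.cons (1 - ∑ i, x i) x, ⟨?_, ?_⟩, ?_⟩
      · intro i
        refine Fin.cases ?_ (fun i => ?_) i
        · simpa using hx1
        · simpa using hx0 i
      · simp [Fin.sum_univ_succ]
      · have := key x
        simp only [Fin.sum_univ_succ, Fin.cons_zero, Fin.cons_succ]
        rw [← this]
  have hvS : volume (WithLp.ofLp (p := 2) ⁻¹' S) = ENNReal.ofReal (1 / d.factorial) := by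
    have h := (PiLp.volume_preserving_ofLp (Fin d)).measure_preimage_equiv (f := (MeasurableEquiv.toLp 2 _).symm) S
    have h2 := vol_corner d 1 zero_le_one
    rw [one_pow] at h2
    rw [← h2]
    exact h
  rw [himg, Set.image_add_left, measure_preimage_add, Measure.addHaar_image_linearMap, hvS, LinearMap.det_toLpLin, Matrix.det_transpose]
  rw [ENNReal.toReal_mul, ENNReal.toReal_ofReal (by positivity), ENNReal.toReal_ofReal (by positivity)]
  ring

lemma det_cons {d : ℕ} (v : Fin (d + 1) → EuclideanSpace ℝ (Fin d)) (c : ℝ) :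
    (Matrix.of fun i : Fin (d + 1) => (Fin.cons c (v i) : Fin (d + 1) → ℝ)).det =
      c * (Matrix.of fun i j : Fin d => v i.succ j - v 0 j).det := by
  rw [Matrix.det_eq_of_forall_row_eq_smul_add_const
    (B := Matrix.of fun i : Fin (d + 1) => Fin.cases (Fin.cons c (v 0)) (fun k => Fin.cons 0 (fun j => v k.succ j - v 0 j)) i) (fun i => if i = 0 then 0 else 1) 0 (by simp)]
  · rw [Matrix.det_succ_column_zero, Fin.sum_univ_succ]
    simp
    left
    rfl
  · intro i j
    refine Fin.cases ?_ (fun i => ?_) i <;> refine Fin.cases ?_ (fun j => ?_) j <;> simp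

lemma gram_cons {d : ℕ} (v : Fin (d + 1) → EuclideanSpace ℝ (Fin d)) (c : ℝ) (i j : Fin (d+1)) :
    ((Matrix.of fun i : Fin (d + 1) => (Fin.cons c (v i) : Fin (d + 1) → ℝ)) *
      (Matrix.of fun i : Fin (d + 1) => (Fin.cons c (v i) : Fin (d + 1) → ℝ)).transpose) i j = c ^ 2 + ⟪v i, v j⟫ := by
  simp [Matrix.mul_apply, Fin.sum_univ_succ, PiLp.inner_apply, mul_comm, sq]

lemma bound_sq_s5 (d : ℕ) (hd : 1 ≤ d) : (((d : ℝ) + 1) ^ (((d : ℝ) + 1) / 2) /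
            ((d : ℝ) ^ ((d : ℝ) / 2) * (Nat.factorial d : ℝ))) ^ 2 * d.factorial ^ 2 = d * (((d:ℝ) + 1) / d) ^ (d + 1) := by
  have h0 : (0:ℝ) < d := by exact_mod_cast hd
  have h1 : (((d : ℝ) + 1) ^ (((d : ℝ) + 1) / 2)) ^ 2 = ((d:ℝ)+1) ^ (d+1) := by
    rw [← Real.rpow_natCast, ← Real.rpow_mul (by positivity), ← Real.rpow_natCast]
    congr 1; push_cast; ring
  have h2 : ((d : ℝ) ^ ((d : ℝ) / 2)) ^ 2 = (d:ℝ) ^ d := by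
    rw [← Real.rpow_natCast, ← Real.rpow_mul (by positivity), ← Real.rpow_natCast]
    congr 1; push_cast; ring
  rw [div_pow, mul_pow, h1, h2, div_pow, pow_succ (d:ℝ) d]
  field_simp

/-- volume, Gram determinant. -/
lemma vol_sq {d : ℕ} (hd : 1 ≤ d) (v : Fin (d + 1) → EuclideanSpace ℝ (Fin d)) :
    (volume (convexHull ℝ (Set.range v))).toReal ^ 2 * d.factorial ^ 2 =
     d * (Matrix.of fun i j : Fin (d+1) => 1 / (d:ℝ) + ⟪v i, v j⟫).det := by
  have h0 : (0:ℝ) < d := by exact_mod_cast hd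
  have hG : (Matrix.of fun i j : Fin (d+1) => 1 / (d:ℝ) + ⟪v i, v j⟫) = 
    ((Matrix.of fun i : Fin (d + 1) => (Fin.cons (√(1/d)) (v i) : Fin (d + 1) → ℝ)) *
      (Matrix.of fun i : Fin (d + 1) => (Fin.cons (√(1/d)) (v i) : Fin (d + 1) → ℝ)).transpose) := by
    ext i j
    rw [gram_cons, Real.sq_sqrt (by positivity)]; rfl
  rw [hG, Matrix.det_mul, Matrix.det_transpose, det_cons, simplex_vol, div_pow, sq_abs]
  have := Real.sq_sqrt (show (0:ℝ) ≤ 1/d by positivity)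
  set D := (Matrix.of fun i j : Fin d => v i.succ j - v 0 j).det
  have h3 : (d:ℝ) * (√(1/d) * D * (√(1/d) * D)) = d * (√(1/d))^2 * D^2 := by ring
  rw [h3, this]
  field_simp

lemma gram_psd {d : ℕ} (v : Fin (d + 1) → EuclideanSpace ℝ (Fin d)) :
    (Matrix.of fun i j : Fin (d+1) => 1 / (d:ℝ) + ⟪v i, v j⟫).PosSemidef := by
  have hG : (Matrix.of fun i j : Fin (d+1) => 1 / (d:ℝ) + ⟪v i, v j⟫) = 
    ((Matrix.of fun i : Fin (d + 1) => (Fin.cons (√(1/d)) (v i) : Fin (d + 1) → ℝ)) *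
      (Matrix.of fun i : Fin (d + 1) => (Fin.cons (√(1/d)) (v i) : Fin (d + 1) → ℝ)).transpose) := by
    ext i j
    rw [gram_cons, Real.sq_sqrt (by positivity)]; rfl
  rw [hG]
  simpa using Matrix.posSemidef_self_mul_conjTranspose (Matrix.of fun i : Fin (d + 1) => (Fin.cons (√(1/d)) (v i) : Fin (d + 1) → ℝ))

lemma main_indexed {d : ℕ} (hd : 1 ≤ d) (v : Fin (d + 1) → EuclideanSpace ℝ (Fin d)) (hv : ∀ i, ‖v i‖ = 1) :
    (volume (convexHull ℝ (Set.range v))).toReal ≤ ((d : ℝ) + 1) ^ (((d : ℝ) + 1) / 2) /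
            ((d : ℝ) ^ ((d : ℝ) / 2) * (Nat.factorial d : ℝ)) ∧
    ((volume (convexHull ℝ (Set.range v))).toReal = ((d : ℝ) + 1) ^ (((d : ℝ) + 1) / 2) /
            ((d : ℝ) ^ ((d : ℝ) / 2) * (Nat.factorial d : ℝ)) ↔
     ∀ i j, i ≠ j → ⟪v i, v j⟫ = -(1 / (d:ℝ))) := by
  have h0 : (0:ℝ) < d := by exact_mod_cast hd
  have h1 := vol_sq hd v
  have h2 := bound_sq_s5 d hd
  have hB : 0 ≤ ((d : ℝ) + 1) ^ (((d : ℝ) + 1) / 2) /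
            ((d : ℝ) ^ ((d : ℝ) / 2) * (Nat.factorial d : ℝ)) := by positivity
  have hV : 0 ≤ (volume (convexHull ℝ (Set.range v))).toReal := ENNReal.toReal_nonneg
  have hf : (0:ℝ) < (d.factorial : ℝ)^2 := by positivity
  have h3 := hadamard_psd _ (gram_psd v) (((d:ℝ) + 1) / d) (by positivity) (fun i => by
    simp [hv]; field_simp; ring)
  set B := ((d : ℝ) + 1) ^ (((d : ℝ) + 1) / 2) /
            ((d : ℝ) ^ ((d : ℝ) / 2) * (Nat.factorial d : ℝ))
  set W := (volume (convexHull ℝ (Set.range v))).toReal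
  set G := (Matrix.of fun i j : Fin (d+1) => 1 / (d:ℝ) + ⟪v i, v j⟫) with hG
  refine ⟨?_, ?_, ?_⟩
  · refine (sq_le_sq₀ hV hB).1 (le_of_mul_le_mul_right ?_ hf)
    rw [h1, h2]
    exact mul_le_mul_of_nonneg_left h3.1 h0.le
  · intro h i j hij
    rw [h, h2] at h1
    have h4 := h3.2 (mul_left_cancel₀ h0.ne' h1).symm
    have h5 := congrFun (congrFun h4 i) j
    simp [hG, hij] at h5
    rw [one_div]; linarith
  · intro h
    have h4 : G = (((d:ℝ) + 1) / d) • (1 : Matrix (Fin (d+1)) (Fin (d+1)) ℝ) := by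
      ext i j
      by_cases hij : i = j
      · subst hij
        simp [hG, hv]; field_simp; ring
      · simp [hG, hij, h i j hij]
    have h5 : G.det = (((d:ℝ) + 1) / d) ^ (d+1) := by
      rw [h4, Matrix.det_smul]; simp
    rw [h5, ← h2] at h1
    exact (sq_eq_sq₀ hV hB).1 (mul_right_cancel₀ hf.ne' h1)

lemma exists_regular {d : ℕ} (hd : 1 ≤ d) : ∃ v : Fin (d + 1) → EuclideanSpace ℝ (Fin d),
    (∀ i, ‖v i‖ = 1) ∧ ∀ i j, i ≠ j → ⟪v i, v j⟫ = -(1 / (d:ℝ)) := by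
  have h0 : (0:ℝ) < d := by exact_mod_cast hd
  let u : EuclideanSpace ℝ (Fin (d+1)) := WithLp.toLp 2 fun _ => √(1 / (d + 1))
  have hu : ‖u‖ = 1 := by
    simp only [u, EuclideanSpace.norm_eq, norm_eq_abs, sq_abs]
    rw [Real.sq_sqrt (by positivity)]
    simp
    field_simp
  obtain ⟨b, hb⟩ := Orthonormal.exists_orthonormalBasis_extension_of_card_eq (𝕜 := ℝ) (ι := Fin (d+1))
    (E := EuclideanSpace ℝ (Fin (d+1))) (by simp) (v := fun _ => u) (s := {0}) (by
      constructor
      · intro i; simpa using hu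
      · intro i j hij; exact (hij (Subsingleton.elim _ _)).elim)
  have hb0 : b 0 = u := hb 0 rfl
  have hrow : ∀ i j, ∑ k, b k i * b k j = if i = j then 1 else 0 := by
    intro i j
    have := b.sum_inner_mul_inner (EuclideanSpace.single i 1) (EuclideanSpace.single j 1)
    simp [EuclideanSpace.inner_single_left, EuclideanSpace.inner_single_right, Pi.single_apply] at this
    rw [this]; simp only [eq_comm]
  have hin : ∀ i j, ∑ k : Fin d, b k.succ i * b k.succ j = (if i = j then 1 else 0) - 1 / (d + 1) := by
    intro i j
    have := hrow i j
    rw [Fin.sum_univ_succ, hb0] at this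
    simp only [u] at this
    rw [Real.mul_self_sqrt (by positivity)] at this
    linarith
  let v : Fin (d+1) → EuclideanSpace ℝ (Fin d) := fun i => WithLp.toLp 2 fun k => √((d+1)/d) * b k.succ i
  have hvv : ∀ i j, ⟪v i, v j⟫ = (d+1)/d * ((if i = j then 1 else 0) - 1 / (d + 1)) := by
    intro i j
    rw [← hin, Finset.mul_sum]
    simp only [v, PiLp.inner_apply]
    refine Finset.sum_congr rfl fun k _ => ?_
    have := Real.mul_self_sqrt (show (0:ℝ) ≤ (d+1)/d by positivity)
    nth_rewrite 3 [← this]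
    simp
    ring
  refine ⟨v, fun i => ?_, fun i j hij => ?_⟩
  · have := hvv i i
    rw [real_inner_self_eq_norm_sq] at this
    have h1 : ‖v i‖ ^ 2 = 1 := by rw [this]; simp; field_simp; ring
    exact (sq_eq_sq₀ (norm_nonneg _) zero_le_one).1 (by rw [h1, one_pow])
  · rw [hvv]; simp [hij]; field_simp

lemma exists_enum {d : ℕ} (V : Finset (EuclideanSpace ℝ (Fin d)))
    (hV : (V : Set (EuclideanSpace ℝ (Fin d))) ⊆ Metric.sphere 0 1) (hc : V.card = d + 1) :
    ∃ v : Fin (d + 1) → EuclideanSpace ℝ (Fin d), Set.range v = V ∧ ∀ i, ‖v i‖ = 1 := by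
  let e := V.equivFinOfCardEq hc
  refine ⟨fun i => (e.symm i : EuclideanSpace ℝ (Fin d)), ?_, fun i => ?_⟩
  · ext x
    constructor
    · rintro ⟨i, rfl⟩; exact (e.symm i).2
    · intro hx; exact ⟨e ⟨x, hx⟩, by simp⟩
  · simpa using hV (e.symm i).2


theorem max_volume_simplex (d : ℕ) (hd : 1 ≤ d) :
    (∀ V : Finset (EuclideanSpace ℝ (Fin d)),
        (V : Set (EuclideanSpace ℝ (Fin d))) ⊆ Metric.sphere 0 1 → V.card = d + 1 →
        (volume (convexHull ℝ (V : Set (EuclideanSpace ℝ (Fin d))))).toReal ≤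
          ((d : ℝ) + 1) ^ (((d : ℝ) + 1) / 2) /
            ((d : ℝ) ^ ((d : ℝ) / 2) * (Nat.factorial d : ℝ))) ∧
    (∃ V : Finset (EuclideanSpace ℝ (Fin d)),
        (V : Set (EuclideanSpace ℝ (Fin d))) ⊆ Metric.sphere 0 1 ∧ V.card = d + 1 ∧
        (volume (convexHull ℝ (V : Set (EuclideanSpace ℝ (Fin d))))).toReal =
          ((d : ℝ) + 1) ^ (((d : ℝ) + 1) / 2) /
            ((d : ℝ) ^ ((d : ℝ) / 2) * (Nat.factorial d : ℝ))) ∧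
    (∀ V : Finset (EuclideanSpace ℝ (Fin d)),
        (V : Set (EuclideanSpace ℝ (Fin d))) ⊆ Metric.sphere 0 1 → V.card = d + 1 →
        (volume (convexHull ℝ (V : Set (EuclideanSpace ℝ (Fin d))))).toReal =
          ((d : ℝ) + 1) ^ (((d : ℝ) + 1) / 2) /
            ((d : ℝ) ^ ((d : ℝ) / 2) * (Nat.factorial d : ℝ)) →
        ∀ u ∈ V, ∀ v ∈ V, u ≠ v → ⟪u, v⟫ = -(1 / (d : ℝ))) := by

  refine ⟨?_, ?_, ?_⟩
  · intro V hV hc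
    obtain ⟨v, hr, hv⟩ := exists_enum V hV hc
    rw [← hr]
    exact (main_indexed hd v hv).1
  · obtain ⟨v, hv, hin⟩ := exists_regular hd
    have h0 : (0:ℝ) < d := by exact_mod_cast hd
    have hinj : Function.Injective v := by
      intro i j hij
      by_contra hne
      have := hin i j hne
      rw [hij, real_inner_self_eq_norm_sq, hv] at this
      have : 0 < 1 / (d:ℝ) := by positivity
      linarith
    classical
    refine ⟨Finset.univ.image v, ?_, ?_, ?_⟩
    · intro x hx
      simp at hx
      obtain ⟨i, rfl⟩ := hx
      simp [hv]
    · rw [Finset.card_image_of_injective _ hinj]; simp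
    · have : ((Finset.univ.image v : Finset _) : Set (EuclideanSpace ℝ (Fin d))) = Set.range v := by simp
      rw [this]
      exact (main_indexed hd v hv).2.2 hin
  · intro V hV hc heq u hu w hw huw
    obtain ⟨v, hr, hv⟩ := exists_enum V hV hc
    rw [← hr] at heq
    have hu' : u ∈ Set.range v := hr ▸ hu
    have hw' : w ∈ Set.range v := hr ▸ hw
    obtain ⟨i, rfl⟩ := hu'
    obtain ⟨j, rfl⟩ := hw'
    exact (main_indexed hd v hv).2.1 heq i j fun h => huw (by rw [h])
end
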